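/- There exist constants N₀ and C > 0, independent of ε, such that for every ε ∈ (0,1] and every integer N ≥ N₀ divisible by 4 the following holds. Let X_0 < … < X_N be the coarse Shishkin mesh with γ₀ = min{c₀,1}, let y^H be the unique solution of the nonlinear discrete scheme on this coarse mesh, and let ŷ : [0,1] → ℝ be its continuous piecewise linear interpolant. Let n = N², let x_0 < … < x_n be the fine Shishkin mesh with the same γ₀ (transition parameter built from ln n), and let y^h be the unique solution of the linear fine-mesh scheme −ε² y_{x̄x̂,i} + f_u(x_i, ŷ(x_i)) y_i = f_u(x_i, ŷ(x_i)) ŷ(x_i) − f(x_i, ŷ(x_i)), i = 1,…,n−1, y_0 = y_n = 0. Then the continuous piecewise linear interpolant u^I_{h,H} of y^h on the fine mesh satisfies max_{x∈[0,1]} |u^I_{h,H}(x) − u(x)| ≤ C N^{−4} (ln N)⁴, where u is the solution of the continuous problem. -/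

import Mathlib

open Set Real

noncomputable section

/-- first partial derivative of `f(x,u)` with respect to `u` -/
def pderiv1 (f : ℝ → ℝ → ℝ) (x y : ℝ) : ℝ := deriv (fun z => f x z) y

/-- second partial derivative of `f(x,u)` with respect to `u` -/
def pderiv2 (f : ℝ → ℝ → ℝ) (x y : ℝ) : ℝ :=
  deriv (fun z => deriv (fun w => f x w) z) y

/-- `f` is four times continuously differentiable on `[0,1] × ℝ`. -/
def SmoothF (f : ℝ → ℝ → ℝ) : Prop :=
  ContDiffOn ℝ 4 (fun p : ℝ × ℝ => f p.1 p.2) ((Icc (0:ℝ) 1) ×ˢ (univ : Set ℝ))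

/-- the stability condition `f_u(x,u) ≥ c₀² > 0` on `[0,1] × ℝ` -/
def LowerF (f : ℝ → ℝ → ℝ) (c₀ : ℝ) : Prop :=
  ∀ x ∈ Icc (0:ℝ) 1, ∀ y : ℝ, c₀ ^ 2 ≤ pderiv1 f x y

/-- `u` is a C⁴-solution of the semilinear BVP `-ε²u'' + f(x,u) = 0`, `u(0)=u(1)=0`. -/
def IsSolution (f : ℝ → ℝ → ℝ) (ε : ℝ) (u : ℝ → ℝ) : Prop :=
  ContDiffOn ℝ 4 u (Icc (0:ℝ) 1) ∧
  (∀ x ∈ Ioo (0:ℝ) 1,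
    -ε ^ 2 * iteratedDerivWithin 2 u (Icc (0:ℝ) 1) x + f x (u x) = 0) ∧
  u 0 = 0 ∧ u 1 = 0

/-- the constant `l = c₀⁻² · max_{[0,1]} |f(x,0)|` -/
def lconst (f : ℝ → ℝ → ℝ) (c₀ : ℝ) : ℝ :=
  c₀ ^ (-2 : ℤ) * sSup ((fun x => |f x 0|) '' Icc (0:ℝ) 1)

/-- the constant `θ = max { |f_uu(x,ξ)| : x ∈ [0,1], |ξ| ≤ l + 2ρ }` -/
def thconst (f : ℝ → ℝ → ℝ) (c₀ ρ : ℝ) : ℝ :=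
  sSup ((fun p : ℝ × ℝ => |pderiv2 f p.1 p.2|) ''
    ((Icc (0:ℝ) 1) ×ˢ (Icc (-(lconst f c₀ + 2*ρ)) (lconst f c₀ + 2*ρ))))

/-- discrete second difference `y_{x̄x̂,i}` on a nonuniform mesh `x` (for `1 ≤ i`),
using `ℏ_i = (h_i + h_{i+1})/2 = (x_{i+1} - x_{i-1})/2`. -/
def ddiff (x y : ℕ → ℝ) (i : ℕ) : ℝ :=
  2 / (x (i+1) - x (i-1)) *
    ((y (i+1) - y i) / (x (i+1) - x i) - (y i - y (i-1)) / (x i - x (i-1)))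

/-- Shishkin mesh generating function with transition parameter
`α = min(1/4, 2γ₀⁻¹ ε ln n)`. -/
def shishkinLam (γ₀ ε : ℝ) (n : ℕ) (t : ℝ) : ℝ :=
  let α := min (1/4) (2 * γ₀⁻¹ * ε * Real.log n)
  if t ≤ 1/4 then 4*α*t
  else if t ≤ 1/2 then α + 2*(1-2*α)*(t-1/4)
  else 1 - (if 1-t ≤ 1/4 then 4*α*(1-t) else α + 2*(1-2*α)*((1-t)-1/4))

/-- Shishkin mesh nodes `x_i = λ(i/n)` -/
def shishkinMesh (γ₀ ε : ℝ) (n i : ℕ) : ℝ := shishkinLam γ₀ ε n ((i:ℝ)/(n:ℝ))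

def bakhPhi (a ε q t : ℝ) : ℝ := a*ε*Real.log (q/(q-t))

/-- derivative of `bakhPhi` -/
def bakhPhi' (a ε q t : ℝ) : ℝ := a*ε/(q-t)

/-- `α ∈ (0,q)` is the abscissa of the contact point of the tangent line from
`(1/2,1/2)` to `φ`, i.e. `φ(α) + φ'(α)(1/2 - α) = 1/2`. -/
def IsBakhAlpha (a ε q α : ℝ) : Prop :=
  α ∈ Ioo 0 q ∧ bakhPhi a ε q α + bakhPhi' a ε q α * (1/2 - α) = 1/2

/-- Bakhvalov mesh generating function -/
def bakhLam (a ε q α t : ℝ) : ℝ :=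
  if t ≤ α then bakhPhi a ε q t
  else if t ≤ 1/2 then bakhPhi a ε q α + bakhPhi' a ε q α * (t-α)
  else 1 - (if 1-t ≤ α then bakhPhi a ε q (1-t)
            else bakhPhi a ε q α + bakhPhi' a ε q α * ((1-t)-α))

/-- Bakhvalov mesh nodes `x_i = λ(i/n)` -/
def bakhMesh (a ε q α : ℝ) (n i : ℕ) : ℝ := bakhLam a ε q α ((i:ℝ)/(n:ℝ))

def vulAlpha (a ε q : ℝ) : ℝ :=
  (q - Real.sqrt (ε*a*q*(1-2*q+2*ε*a)))/(1+2*ε*a)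

def vulMu (a ε q t : ℝ) : ℝ := a*ε*t/(q-t)

/-- derivative of `vulMu` -/
def vulMu' (a ε q t : ℝ) : ℝ := a*ε*q/(q-t)^2

/-- Vulanović mesh generating function -/
def vulLam (a ε q t : ℝ) : ℝ :=
  let α := vulAlpha a ε q
  if t ≤ α then vulMu a ε q t
  else if t ≤ 1/2 then vulMu a ε q α + vulMu' a ε q α * (t-α)
  else 1 - (if 1-t ≤ α then vulMu a ε q (1-t)
            else vulMu a ε q α + vulMu' a ε q α * ((1-t)-α))

/-- Vulanović mesh nodes `x_i = λ(i/n)` -/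
def vulMesh (a ε q : ℝ) (n i : ℕ) : ℝ := vulLam a ε q ((i:ℝ)/(n:ℝ))

/-- the three-point discrete scheme for the linear problem
`-ε² y_{x̄x̂,i} + b(x_i) y_i = g(x_i)`, `y_0 = y_n = 0` -/
def LinScheme (bc gc : ℝ → ℝ) (ε : ℝ) (x : ℕ → ℝ) (n : ℕ) (y : ℕ → ℝ) : Prop :=
  (∀ i : ℕ, 1 ≤ i → i < n →
    -ε ^ 2 * ddiff x y i + bc (x i) * y i = gc (x i)) ∧
  y 0 = 0 ∧ y n = 0

/-- the nonlinear discrete scheme `-ε² y_{x̄x̂,i} + f(x_i, y_i) = 0`, `y_0 = y_n = 0` -/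
def NonlinScheme (f : ℝ → ℝ → ℝ) (ε : ℝ) (x : ℕ → ℝ) (n : ℕ) (y : ℕ → ℝ) : Prop :=
  (∀ i : ℕ, 1 ≤ i → i < n → -ε ^ 2 * ddiff x y i + f (x i) (y i) = 0) ∧
  y 0 = 0 ∧ y n = 0

/-- `u` is a C²-solution of the continuous linear problem
`-ε²u'' + b(x)u = g(x)`, `u(0)=u(1)=0`. -/
def IsLinSolution (bc gc : ℝ → ℝ) (ε : ℝ) (u : ℝ → ℝ) : Prop :=
  ContDiffOn ℝ 2 u (Icc (0:ℝ) 1) ∧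
  (∀ x ∈ Ioo (0:ℝ) 1,
    -ε ^ 2 * iteratedDerivWithin 2 u (Icc (0:ℝ) 1) x + bc x * u x = gc x) ∧
  u 0 = 0 ∧ u 1 = 0

/-- `b(x,ε)` is three times continuously differentiable in `x` on `[0,1]`,
with these derivatives bounded uniformly in `ε ∈ [0,1]`. -/
def UnifC3 (b : ℝ → ℝ → ℝ) : Prop :=
  ∃ M : ℝ, ∀ ε ∈ Icc (0:ℝ) 1,
    ContDiffOn ℝ 3 (fun x => b x ε) (Icc (0:ℝ) 1) ∧
    ∀ j : ℕ, j ≤ 3 → ∀ x ∈ Icc (0:ℝ) 1,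
      |iteratedDerivWithin j (fun x => b x ε) (Icc (0:ℝ) 1) x| ≤ M

/-- `w` is the continuous piecewise-linear interpolant of mesh data `y`
on the mesh `x_0 < … < x_n`. -/
def IsLinInterp (x : ℕ → ℝ) (n : ℕ) (y : ℕ → ℝ) (w : ℝ → ℝ) : Prop :=
  (∀ i ≤ n, w (x i) = y i) ∧
  ∀ i < n, ∀ t ∈ Icc (x i) (x (i+1)),
    w t = y i + (y (i+1) - y i) * (t - x i) / (x (i+1) - x i)

/-- properties of the initial guess `u⁰`: of class C³, within `ρ` of the
solution `u`, and satisfying ε-uniform bounds of layer type for `j = 0, 1`. -/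
def InitGuess (c₀ ε C₀ ρ : ℝ) (u u0 : ℝ → ℝ) : Prop :=
  ContDiffOn ℝ 3 u0 (Icc (0:ℝ) 1) ∧
  (∀ x ∈ Icc (0:ℝ) 1, |u0 x - u x| ≤ ρ) ∧
  (∀ x ∈ Icc (0:ℝ) 1, |u0 x| ≤ C₀) ∧
  (∀ x ∈ Icc (0:ℝ) 1, |derivWithin u0 (Icc (0:ℝ) 1) x| ≤
    C₀ * (1 + ε⁻¹ * (Real.exp (-c₀*x/ε) + Real.exp (-c₀*(1-x)/ε))))

/-- the discrete Newton (quasilinearization) iterates on the mesh `x`: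
`y⁰_i = u⁰(x_i)` and `y^{m+1}` solves the quasilinearized discrete problem. -/
def NewtonIter (f : ℝ → ℝ → ℝ) (ε : ℝ) (x : ℕ → ℝ) (n : ℕ) (u0 : ℝ → ℝ)
    (Y : ℕ → ℕ → ℝ) : Prop :=
  (∀ i ≤ n, Y 0 i = u0 (x i)) ∧
  ∀ m : ℕ,
    (∀ i : ℕ, 1 ≤ i → i < n →
      -ε ^ 2 * ddiff x (Y (m+1)) i + pderiv1 f (x i) (Y m i) * Y (m+1) i
        = -f (x i) (Y m i) + pderiv1 f (x i) (Y m i) * Y m i) ∧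
    Y (m+1) 0 = 0 ∧ Y (m+1) n = 0


open Topology Filter

/-- uncurried `f` -/
def unc (f : ℝ → ℝ → ℝ) : ℝ × ℝ → ℝ := fun p => f p.1 p.2

lemma f_diff {f : ℝ → ℝ → ℝ} {c₀ : ℝ} (hc₀ : 0 < c₀) (hfu : LowerF f c₀) {x : ℝ}
    (hx : x ∈ Icc (0:ℝ) 1) : Differentiable ℝ (f x) := by
  intro y
  by_contra h
  have h1 := hfu x hx y
  have h2 : pderiv1 f x y = 0 := deriv_zero_of_not_differentiableAt h
  have : 0 < c₀ ^ 2 := by positivity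
  linarith

lemma f_mono {f : ℝ → ℝ → ℝ} {c₀ : ℝ} (hc₀ : 0 < c₀) (hfu : LowerF f c₀) {x : ℝ}
    (hx : x ∈ Icc (0:ℝ) 1) {a b : ℝ} (hab : a ≤ b) : c₀ ^ 2 * (b - a) ≤ f x b - f x a :=
  mul_sub_le_image_sub_of_le_deriv (f_diff hc₀ hfu hx) (fun y => hfu x hx y) hab

lemma f_slope {f : ℝ → ℝ → ℝ} {c₀ : ℝ} (hc₀ : 0 < c₀) (hfu : LowerF f c₀) {x : ℝ}
    (hx : x ∈ Icc (0:ℝ) 1) (a b : ℝ) : ∃ s, c₀ ^ 2 ≤ s ∧ f x a - f x b = s * (a - b) := by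
  rcases lt_trichotomy a b with h | h | h
  · refine ⟨(f x a - f x b) / (a - b), ?_, ?_⟩
    · rw [le_div_iff_of_neg (by linarith)]
      have := f_mono hc₀ hfu hx h.le
      linarith
    · have : a - b ≠ 0 := by intro h'; linarith
      field_simp
  · exact ⟨c₀ ^ 2, le_refl _, by subst h; ring⟩
  · refine ⟨(f x a - f x b) / (a - b), ?_, ?_⟩
    · rw [le_div_iff₀ (by linarith)]
      have := f_mono hc₀ hfu hx h.le
      linarith
    · have : a - b ≠ 0 := by intro h'; linarith
      field_simp

lemma f_abs {f : ℝ → ℝ → ℝ} {c₀ : ℝ} (hc₀ : 0 < c₀) (hfu : LowerF f c₀) {x : ℝ}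
    (hx : x ∈ Icc (0:ℝ) 1) (a b : ℝ) : c₀ ^ 2 * |a - b| ≤ |f x a - f x b| := by
  obtain ⟨s, hs, h⟩ := f_slope hc₀ hfu hx a b
  rw [h, abs_mul]
  exact mul_le_mul_of_nonneg_right (hs.trans (le_abs_self s)) (abs_nonneg _)

lemma unc_contDiffAt {f : ℝ → ℝ → ℝ} (hf : SmoothF f) {p : ℝ × ℝ} (hp : p.1 ∈ Ioo (0:ℝ) 1) :
    ContDiffAt ℝ 4 (unc f) p := by
  apply ContDiffOn.contDiffAt hf
  rw [show p = (p.1, p.2) from rfl]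
  exact prod_mem_nhds (Icc_mem_nhds hp.1 hp.2) univ_mem

lemma unc_bounds {f : ℝ → ℝ → ℝ} (hf : SmoothF f) (M : ℝ) : ∃ K : ℝ, 0 < K ∧
    ∀ p : ℝ × ℝ, p.1 ∈ Ioo (0:ℝ) 1 → |p.2| ≤ M →
      ‖fderiv ℝ (unc f) p‖ ≤ K ∧ ‖fderiv ℝ (fderiv ℝ (unc f)) p‖ ≤ K := by
  set S : Set (ℝ × ℝ) := (Icc (0:ℝ) 1) ×ˢ (univ : Set ℝ) with hS
  have hU : UniqueDiffOn ℝ S := (uniqueDiffOn_Icc (by norm_num)).prod uniqueDiffOn_univ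
  have h0 : ContDiffOn ℝ 4 (unc f) S := hf
  have h1 : ContDiffOn ℝ 3 (fderivWithin ℝ (unc f) S) S := h0.fderivWithin hU (by norm_num)
  have h2 : ContDiffOn ℝ 2 (fderivWithin ℝ (fderivWithin ℝ (unc f) S) S) S :=
    h1.fderivWithin hU (by norm_num)
  have hK : IsCompact ((Icc (0:ℝ) 1) ×ˢ (Icc (-M) M)) := isCompact_Icc.prod isCompact_Icc
  have hsub : (Icc (0:ℝ) 1) ×ˢ (Icc (-M) M) ⊆ S := prod_mono le_rfl (subset_univ _)
  obtain ⟨K1, hK1⟩ := hK.exists_bound_of_continuousOn (h1.continuousOn.mono hsub)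
  obtain ⟨K2, hK2⟩ := hK.exists_bound_of_continuousOn
    (E := ℝ × ℝ →L[ℝ] ℝ × ℝ →L[ℝ] ℝ) (h2.continuousOn.mono hsub)
  refine ⟨max (max K1 K2) 1, by positivity, fun p hp hpM => ?_⟩
  have hmem : p ∈ (Icc (0:ℝ) 1) ×ˢ (Icc (-M) M) := ⟨Ioo_subset_Icc_self hp, abs_le.1 hpM⟩
  have hnh : ∀ q : ℝ × ℝ, q.1 ∈ Ioo (0:ℝ) 1 → S ∈ 𝓝 q := fun q hq => by
    rw [show q = (q.1, q.2) from rfl]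
    exact prod_mem_nhds (Icc_mem_nhds hq.1 hq.2) univ_mem
  have e1 : ∀ q : ℝ × ℝ, q.1 ∈ Ioo (0:ℝ) 1 → fderivWithin ℝ (unc f) S q = fderiv ℝ (unc f) q :=
    fun q hq => fderivWithin_of_mem_nhds (hnh q hq)
  have hop : ∀ᶠ q : ℝ × ℝ in 𝓝 p, q.1 ∈ Ioo (0:ℝ) 1 :=
    continuous_fst.continuousAt.eventually (Ioo_mem_nhds hp.1 hp.2)
  have e2 : fderivWithin ℝ (fderivWithin ℝ (unc f) S) S p = fderiv ℝ (fderiv ℝ (unc f)) p := by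
    rw [fderivWithin_of_mem_nhds (hnh p hp)]
    apply Filter.EventuallyEq.fderiv_eq
    filter_upwards [hop] with q hq using e1 q hq
  constructor
  · rw [← e1 p hp]
    exact (hK1 p hmem).trans ((le_max_left _ _).trans (le_max_left _ _))
  · rw [← e2]
    exact (hK2 p hmem).trans ((le_max_right _ _).trans (le_max_left _ _))

lemma curve_deriv {f : ℝ → ℝ → ℝ} (hf : SmoothF f) {g : ℝ → ℝ} {x g1 : ℝ}
    (hx : x ∈ Ioo (0:ℝ) 1) (hg : HasDerivAt g g1 x) :
    HasDerivAt (fun t => f t (g t)) (fderiv ℝ (unc f) (x, g x) (1, g1)) x := by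
  have h1 : HasFDerivAt (unc f) (fderiv ℝ (unc f) (x, g x)) (x, g x) :=
    ((unc_contDiffAt hf (p := (x, g x)) hx).differentiableAt (by norm_num)).hasFDerivAt
  exact h1.comp_hasDerivAt x ((hasDerivAt_id x).prodMk hg)

lemma curve_deriv2 {f : ℝ → ℝ → ℝ} (hf : SmoothF f) {g g1 : ℝ → ℝ} {x g2 : ℝ}
    (hx : x ∈ Ioo (0:ℝ) 1) (hg : HasDerivAt g (g1 x) x) (hg1 : HasDerivAt g1 g2 x) :
    HasDerivAt (fun t => fderiv ℝ (unc f) (t, g t) (1, g1 t))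
      (fderiv ℝ (fderiv ℝ (unc f)) (x, g x) (1, g1 x) (1, g1 x)
        + fderiv ℝ (unc f) (x, g x) (0, g2)) x := by
  have h0 : ContDiffAt ℝ 3 (fderiv ℝ (unc f)) (x, g x) :=
    (unc_contDiffAt hf (p := (x, g x)) hx).fderiv_right (by norm_num)
  have h1 : HasFDerivAt (fderiv ℝ (unc f)) (fderiv ℝ (fderiv ℝ (unc f)) (x, g x)) (x, g x) :=
    (h0.differentiableAt (by norm_num)).hasFDerivAt
  have h2 := h1.comp_hasDerivAt x ((hasDerivAt_id x).prodMk hg)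
  exact h2.clm_apply ((hasDerivAt_const x (1:ℝ)).prodMk hg1)

lemma pderiv1_eq {f : ℝ → ℝ → ℝ} (hf : SmoothF f) {x : ℝ} (hx : x ∈ Ioo (0:ℝ) 1) (y : ℝ) :
    HasDerivAt (f x) (fderiv ℝ (unc f) (x, y) (0, 1)) y := by
  have h1 : HasFDerivAt (unc f) (fderiv ℝ (unc f) (x, y)) (x, y) :=
    ((unc_contDiffAt hf (p := (x, y)) hx).differentiableAt (by norm_num)).hasFDerivAt
  exact h1.comp_hasDerivAt y ((hasDerivAt_const y x).prodMk (hasDerivAt_id y))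

lemma fu_lower {f : ℝ → ℝ → ℝ} {c₀ : ℝ} (hf : SmoothF f) (hfu : LowerF f c₀) {x : ℝ}
    (hx : x ∈ Ioo (0:ℝ) 1) (y : ℝ) : c₀ ^ 2 ≤ fderiv ℝ (unc f) (x, y) (0, 1) := by
  have h := hfu x (Ioo_subset_Icc_self hx) y
  rwa [pderiv1, (pderiv1_eq hf hx y).deriv] at h

lemma norm_pair (a b : ℝ) : ‖((a, b) : ℝ × ℝ)‖ ≤ |a| + |b| := by
  rw [Prod.norm_def]
  simp only [Real.norm_eq_abs]
  exact max_le (by linarith [abs_nonneg b]) (by linarith [abs_nonneg a])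

lemma d1_bound {L : ℝ × ℝ →L[ℝ] ℝ} {K : ℝ} (hL : ‖L‖ ≤ K) (a b : ℝ) :
    |L (a, b)| ≤ K * (|a| + |b|) := by
  have h := L.le_opNorm (a, b)
  rw [Real.norm_eq_abs] at h
  exact h.trans (mul_le_mul hL (norm_pair a b) (norm_nonneg _) ((norm_nonneg _).trans hL))

lemma d2_bound {L : ℝ × ℝ →L[ℝ] ℝ × ℝ →L[ℝ] ℝ} {K : ℝ} (hL : ‖L‖ ≤ K) (a b a' b' : ℝ) :
    |L (a, b) (a', b')| ≤ K * (|a| + |b|) * (|a'| + |b'|) := by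
  apply d1_bound
  exact (L.le_opNorm (a, b)).trans
    (mul_le_mul hL (norm_pair a b) (norm_nonneg _) ((norm_nonneg L).trans hL))

/-- the reduced solution -/
lemma reduced {f : ℝ → ℝ → ℝ} {c₀ : ℝ} (hc₀ : 0 < c₀) (hf : SmoothF f) (hfu : LowerF f c₀) :
    ∃ (v v1 v2 : ℝ → ℝ) (R : ℝ), 0 < R ∧ ContinuousOn v (Icc 0 1) ∧
      (∀ x ∈ Icc (0:ℝ) 1, f x (v x) = 0) ∧ (∀ x ∈ Icc (0:ℝ) 1, |v x| ≤ R) ∧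
      (∀ x ∈ Ioo (0:ℝ) 1, HasDerivAt v (v1 x) x ∧ HasDerivAt v1 (v2 x) x ∧
        |v1 x| ≤ R ∧ |v2 x| ≤ R) := by
  have hc2 : 0 < c₀ ^ 2 := by positivity
  have hz : ∀ x ∈ Icc (0:ℝ) 1, ∃ y, f x y = 0 := by
    intro x hx
    set L := |f x 0| / c₀ ^ 2 with hL
    have hL0 : 0 ≤ L := by positivity
    have hLe : c₀ ^ 2 * L = |f x 0| := by rw [hL]; field_simp
    have h1 := f_mono hc₀ hfu hx (a := 0) (b := L) hL0
    have h2 := f_mono hc₀ hfu hx (a := -L) (b := 0) (by linarith)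
    have h3 : (0:ℝ) ∈ Icc (f x (-L)) (f x L) := by
      constructor
      · nlinarith [le_abs_self (f x 0)]
      · nlinarith [neg_abs_le (f x 0)]
    obtain ⟨y, -, hy⟩ := intermediate_value_Icc (by linarith : -L ≤ L)
      (f_diff hc₀ hfu hx).continuous.continuousOn h3
    exact ⟨y, hy⟩
  choose! v hv using hz
  have hcontf : ContinuousOn (unc f) ((Icc (0:ℝ) 1) ×ˢ univ) := ContDiffOn.continuousOn hf
  have hcx : ∀ y, ContinuousOn (fun x => f x y) (Icc 0 1) := by
    intro y
    exact hcontf.comp (f := fun x : ℝ => (x, y)) (by fun_prop) (fun x hx => ⟨hx, mem_univ _⟩)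
  have hv_abs : ∀ x ∈ Icc (0:ℝ) 1, ∀ y, |v x - y| ≤ |f x y| / c₀ ^ 2 := by
    intro x hx y
    have := f_abs hc₀ hfu hx (v x) y
    rw [hv x hx, zero_sub, abs_neg] at this
    rw [le_div_iff₀ hc2]; linarith
  have hvc : ContinuousOn v (Icc 0 1) := by
    intro x0 hx0
    have h1 : Tendsto (fun x => |f x (v x0)| / c₀ ^ 2) (𝓝[Icc 0 1] x0) (𝓝 0) := by
      have := ((hcx (v x0) x0 hx0).abs.div_const (c₀ ^ 2))
      have h2 := this.tendsto
      simpa [hv x0 hx0] using h2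
    have h2 : Tendsto (fun x => v x - v x0) (𝓝[Icc 0 1] x0) (𝓝 0) := by
      apply squeeze_zero_norm' _ h1
      filter_upwards [self_mem_nhdsWithin] with x hx using hv_abs x hx _
    have := h2.add_const (v x0)
    simpa [ContinuousWithinAt] using this
  obtain ⟨M, hM⟩ := isCompact_Icc.exists_bound_of_continuousOn hvc
  simp only [Real.norm_eq_abs] at hM
  obtain ⟨K, hK0, hK⟩ := unc_bounds hf M
  have hcd : ∀ x ∈ Ioo (0:ℝ) 1, ContDiffAt ℝ 4 v x := by
    intro x hx
    have cdf := unc_contDiffAt hf (p := (x, v x)) hx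
    have hinv : (fderiv ℝ (unc f) (x, v x) ∘L .inr ℝ ℝ ℝ).IsInvertible := by
      have hne : fderiv ℝ (unc f) (x, v x) (0, 1) ≠ 0 :=
        (hc2.trans_le (fu_lower hf hfu hx (v x))).ne'
      refine ⟨ContinuousLinearEquiv.unitsEquivAut ℝ (Units.mk0 _ hne), ?_⟩
      ext
      simp
    have hi := cdf.contDiffAt_implicitFunction (by norm_num) hinv
    refine hi.congr_of_eventuallyEq ?_
    have he := cdf.eventually_apply_implicitFunction (by norm_num) hinv
    filter_upwards [he, Ioo_mem_nhds hx.1 hx.2] with t ht htI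
    have h1 : unc f (x, v x) = 0 := hv x (Ioo_subset_Icc_self hx)
    rw [h1] at ht
    have h2 := hv_abs t (Ioo_subset_Icc_self htI) (cdf.implicitFunction (by norm_num) hinv t)
    have h3 : f t (cdf.implicitFunction (by norm_num) hinv t) = 0 := ht
    rw [h3, abs_zero, zero_div] at h2
    exact sub_eq_zero.1 (abs_nonpos_iff.1 h2)
  have hd1 : ∀ x ∈ Ioo (0:ℝ) 1, HasDerivAt v (deriv v x) x := fun x hx =>
    ((hcd x hx).differentiableAt (by norm_num)).hasDerivAt
  have hd2 : ∀ x ∈ Ioo (0:ℝ) 1, HasDerivAt (deriv v) (deriv (deriv v) x) x := fun x hx => by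
    have : ContDiffAt ℝ 3 (deriv v) x := by
      exact (hcd x hx).derivWithin (by norm_num)
    exact (this.differentiableAt (by norm_num)).hasDerivAt
  set R1 := K / c₀ ^ 2 with hR1
  set R2 := K * (1 + R1) * (1 + R1) / c₀ ^ 2 with hR2
  have hR1p : 0 < R1 := by positivity
  have hR2p : 0 < R2 := by positivity
  have hb1 : ∀ x ∈ Ioo (0:ℝ) 1, fderiv ℝ (unc f) (x, v x) (1, deriv v x) = 0 := by
    intro x hx
    have h1 := curve_deriv hf hx (hd1 x hx)
    have h2 : HasDerivAt (fun t => f t (v t)) 0 x := by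
      refine (hasDerivAt_const x (0:ℝ)).congr_of_eventuallyEq ?_
      filter_upwards [Ioo_mem_nhds hx.1 hx.2] with t ht using hv t (Ioo_subset_Icc_self ht)
    exact h1.unique h2
  have hsm : ∀ (L : ℝ × ℝ →L[ℝ] ℝ) (a : ℝ), L (0, a) = L (0, 1) * a := by
    intro L a
    have : ((0, a) : ℝ × ℝ) = a • (0, 1) := by simp
    rw [this, map_smul, smul_eq_mul, mul_comm]
  have hv1 : ∀ x ∈ Ioo (0:ℝ) 1, |deriv v x| ≤ R1 := by
    intro x hx
    have h := hb1 x hx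
    have h2 : ((1, deriv v x) : ℝ × ℝ) = (1, 0) + (0, deriv v x) := by simp
    rw [h2, map_add, hsm] at h
    have h3 := d1_bound (hK (x, v x) hx (hM x (Ioo_subset_Icc_self hx))).1 1 0
    have h4 : |fderiv ℝ (unc f) (x, v x) (0, 1) * deriv v x| ≤ K := by
      rw [show fderiv ℝ (unc f) (x, v x) (0, 1) * deriv v x
        = - fderiv ℝ (unc f) (x, v x) (1, 0) by linarith, abs_neg]
      simpa using h3
    rw [abs_mul] at h4
    rw [hR1, le_div_iff₀ hc2]
    have h5 := fu_lower hf hfu hx (v x)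
    nlinarith [le_abs_self (fderiv ℝ (unc f) (x, v x) (0, 1)), abs_nonneg (deriv v x)]
  have hv2 : ∀ x ∈ Ioo (0:ℝ) 1, |deriv (deriv v) x| ≤ R2 := by
    intro x hx
    have h1 := curve_deriv2 hf hx (hd1 x hx) (hd2 x hx)
    have h2 : HasDerivAt (fun t => fderiv ℝ (unc f) (t, v t) (1, deriv v t)) 0 x := by
      refine (hasDerivAt_const x (0:ℝ)).congr_of_eventuallyEq ?_
      filter_upwards [Ioo_mem_nhds hx.1 hx.2] with t ht using hb1 t ht
    have h := h1.unique h2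
    rw [hsm] at h
    have h3 := d2_bound (hK (x, v x) hx (hM x (Ioo_subset_Icc_self hx))).2
      1 (deriv v x) 1 (deriv v x)
    have h6 := hv1 x hx
    have h4 : |fderiv ℝ (unc f) (x, v x) (0, 1) * deriv (deriv v) x| ≤ K * (1 + R1) * (1 + R1) := by
      rw [show fderiv ℝ (unc f) (x, v x) (0, 1) * deriv (deriv v) x
        = - fderiv ℝ (fderiv ℝ (unc f)) (x, v x) (1, deriv v x) (1, deriv v x) by linarith, abs_neg]
      refine h3.trans ?_
      rw [abs_one]
      gcongr
    rw [abs_mul] at h4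
    rw [hR2, le_div_iff₀ hc2]
    have h5 := fu_lower hf hfu hx (v x)
    nlinarith [le_abs_self (fderiv ℝ (unc f) (x, v x) (0, 1)), abs_nonneg (deriv (deriv v) x)]
  have hM0 : 0 ≤ |M| := abs_nonneg M
  refine ⟨v, deriv v, deriv (deriv v), R1 + R2 + |M|, by positivity, hvc, hv,
    fun x hx => ?_, fun x hx => ⟨hd1 x hx, hd2 x hx, ?_, ?_⟩⟩
  · linarith [hM x hx, le_abs_self M]
  · linarith [hv1 x hx]
  · linarith [hv2 x hx]


/-- the layer function -/
def EE (c₀ ε x : ℝ) : ℝ := exp (-(c₀ / ε) * x) + exp (-(c₀ / ε) * (1 - x))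

/-- derivative of the layer function -/
def EE1 (c₀ ε x : ℝ) : ℝ :=
  -(c₀ / ε) * exp (-(c₀ / ε) * x) + (c₀ / ε) * exp (-(c₀ / ε) * (1 - x))

lemma EE_pos (c₀ ε x : ℝ) : 0 < EE c₀ ε x := by unfold EE; positivity

lemma EE_deriv (c₀ ε x : ℝ) : HasDerivAt (EE c₀ ε) (EE1 c₀ ε x) x := by
  have h1 : HasDerivAt (fun x : ℝ => -(c₀ / ε) * x) (-(c₀ / ε)) x := by
    simpa using (hasDerivAt_id x).const_mul (-(c₀ / ε))
  have h2 : HasDerivAt (fun x : ℝ => -(c₀ / ε) * (1 - x)) (c₀ / ε) x := by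
    have := ((hasDerivAt_id x).const_sub 1).const_mul (-(c₀ / ε))
    simpa using this
  have := h1.exp.add h2.exp
  refine this.congr_deriv ?_
  unfold EE1; ring

lemma EE1_deriv (c₀ ε x : ℝ) : HasDerivAt (EE1 c₀ ε) ((c₀ / ε) ^ 2 * EE c₀ ε x) x := by
  have h1 : HasDerivAt (fun x : ℝ => -(c₀ / ε) * x) (-(c₀ / ε)) x := by
    simpa using (hasDerivAt_id x).const_mul (-(c₀ / ε))
  have h2 : HasDerivAt (fun x : ℝ => -(c₀ / ε) * (1 - x)) (c₀ / ε) x := by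
    have := ((hasDerivAt_id x).const_sub 1).const_mul (-(c₀ / ε))
    simpa using this
  have := (h1.exp.const_mul (-(c₀ / ε))).add (h2.exp.const_mul (c₀ / ε))
  refine this.congr_deriv ?_
  unfold EE; ring

lemma EE_le_two {c₀ ε x : ℝ} (hc₀ : 0 < c₀) (hε : 0 < ε) (hx : x ∈ Icc (0:ℝ) 1) :
    EE c₀ ε x ≤ 2 := by
  have hp : 0 < c₀ / ε := by positivity
  have h1 : exp (-(c₀ / ε) * x) ≤ 1 := by
    rw [exp_le_one_iff]; nlinarith [hx.1]
  have h2 : exp (-(c₀ / ε) * (1 - x)) ≤ 1 := by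
    rw [exp_le_one_iff]; nlinarith [hx.2]
  unfold EE; linarith

lemma EE_shift {c₀ ε : ℝ} (hc₀ : 0 < c₀) (hε : 0 < ε) {x y d : ℝ} (h : |y - x| ≤ d) :
    EE c₀ ε y ≤ exp (c₀ / ε * d) * EE c₀ ε x := by
  have hp : 0 < c₀ / ε := by positivity
  have h' := abs_le.1 h
  unfold EE
  rw [mul_add, ← exp_add, ← exp_add]
  apply add_le_add
  · apply exp_le_exp.2; nlinarith
  · apply exp_le_exp.2; nlinarith

/-- bounds for the solution -/
structure SolB (f : ℝ → ℝ → ℝ) (c₀ A ε : ℝ) (u u1 φ1 φ2 : ℝ → ℝ) : Prop where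
  cu : ContinuousOn u (Icc 0 1)
  cφ : ContinuousOn (fun x => f x (u x)) (Icc 0 1)
  bu : ∀ x ∈ Icc (0:ℝ) 1, |u x| ≤ A
  du : ∀ x ∈ Ioo (0:ℝ) 1, HasDerivAt u (u1 x) x
  du1 : ∀ x ∈ Ioo (0:ℝ) 1, HasDerivAt u1 (f x (u x) / ε ^ 2) x
  dφ : ∀ x ∈ Ioo (0:ℝ) 1, HasDerivAt (fun x => f x (u x)) (φ1 x) x
  dφ1 : ∀ x ∈ Ioo (0:ℝ) 1, HasDerivAt φ1 (φ2 x) x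
  b0 : ∀ x ∈ Ioo (0:ℝ) 1, |f x (u x)| ≤ A * (ε ^ 2 + EE c₀ ε x)
  b1 : ∀ x ∈ Ioo (0:ℝ) 1, |φ1 x| ≤ A * (ε + EE c₀ ε x / ε)
  b2 : ∀ x ∈ Ioo (0:ℝ) 1, |φ2 x| ≤ A * (1 + EE c₀ ε x / ε ^ 2)

lemma second_deriv_test {w w1 : ℝ → ℝ} {x w2 : ℝ} (hm : IsLocalMax w x)
    (h1 : ∀ᶠ y in 𝓝 x, HasDerivAt w (w1 y) y) (h2 : HasDerivAt w1 w2 x) : w2 ≤ 0 := by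
  by_contra hcon
  push Not at hcon
  have e1 : deriv w =ᶠ[𝓝 x] w1 := by
    filter_upwards [h1] with y hy using hy.deriv
  have e2 : deriv (deriv w) x = w2 := by rw [e1.deriv_eq, h2.deriv]
  have hmin : IsLocalMin w x := isLocalMin_of_deriv_deriv_pos (by rw [e2]; exact hcon)
    hm.deriv_eq_zero h1.self_of_nhds.continuousAt
  have hc : w =ᶠ[𝓝 x] fun _ => w x := by
    filter_upwards [hm, hmin] with y hy1 hy2 using le_antisymm hy1 hy2
  have hd : deriv w =ᶠ[𝓝 x] fun _ => 0 := by
    have := hc.deriv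
    simpa using this
  have : deriv (deriv w) x = 0 := by rw [hd.deriv_eq]; simp
  linarith

/-- one-sided continuous maximum principle -/
lemma cmp_aux {c₀ ε R : ℝ} (hc₀ : 0 < c₀) (hε : 0 < ε) {z z1 z2 : ℝ → ℝ} {C : ℝ}
    (hcz : ContinuousOn z (Icc 0 1)) (hz0 : z 0 ≤ C) (hz1 : z 1 ≤ C) (hCp : 0 < C)
    (d1 : ∀ x ∈ Ioo (0:ℝ) 1, HasDerivAt z (z1 x) x)
    (d2 : ∀ x ∈ Ioo (0:ℝ) 1, HasDerivAt z1 (z2 x) x)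
    (hb : ∀ x ∈ Ioo (0:ℝ) 1, 0 ≤ z x → c₀ ^ 2 * z x - ε ^ 2 * R ≤ ε ^ 2 * z2 x)
    (hC : R ≤ c₀ ^ 2 * C) :
    ∀ x ∈ Icc (0:ℝ) 1, z x ≤ C * (ε ^ 2 + EE c₀ ε x) := by
  have hEc : Continuous (EE c₀ ε) :=
    continuous_iff_continuousAt.2 fun x => (EE_deriv c₀ ε x).continuousAt
  have hwc : ContinuousOn (fun x => z x - C * (ε ^ 2 + EE c₀ ε x)) (Icc 0 1) :=
    hcz.sub (continuousOn_const.mul (continuousOn_const.add hEc.continuousOn))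
  obtain ⟨x0, hx0, hmax⟩ := isCompact_Icc.exists_isMaxOn ⟨0, by simp⟩ hwc
  intro x hx
  by_contra hcon
  push Not at hcon
  have hpos : 0 < z x0 - C * (ε ^ 2 + EE c₀ ε x0) := by
    have : z x - C * (ε ^ 2 + EE c₀ ε x) ≤ z x0 - C * (ε ^ 2 + EE c₀ ε x0) := hmax hx
    linarith
  have hE0 : 1 ≤ EE c₀ ε 0 := by unfold EE; simp; positivity
  have hE1 : 1 ≤ EE c₀ ε 1 := by unfold EE; simp; positivity
  have hε2 : 0 < ε ^ 2 := by positivity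
  have hx0' : x0 ∈ Ioo (0:ℝ) 1 := by
    refine ⟨lt_of_le_of_ne hx0.1 ?_, lt_of_le_of_ne hx0.2 ?_⟩
    · rintro rfl
      nlinarith
    · rintro rfl
      nlinarith
  have hloc : IsLocalMax (fun x => z x - C * (ε ^ 2 + EE c₀ ε x)) x0 :=
    hmax.isLocalMax (Icc_mem_nhds hx0'.1 hx0'.2)
  have hdw : ∀ y ∈ Ioo (0:ℝ) 1, HasDerivAt (fun x => z x - C * (ε ^ 2 + EE c₀ ε x))
      (z1 y - C * EE1 c₀ ε y) y := fun y hy =>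
    (d1 y hy).sub (((EE_deriv c₀ ε y).const_add _).const_mul C)
  have hdw2 : HasDerivAt (fun y => z1 y - C * EE1 c₀ ε y)
      (z2 x0 - C * ((c₀ / ε) ^ 2 * EE c₀ ε x0)) x0 :=
    (d2 x0 hx0').sub ((EE1_deriv c₀ ε x0).const_mul C)
  have hs := second_deriv_test hloc
    (by filter_upwards [Ioo_mem_nhds hx0'.1 hx0'.2] with y hy using hdw y hy) hdw2
  have hEp := EE_pos c₀ ε x0
  have hz : 0 ≤ z x0 := by
    have : 0 ≤ C * (ε ^ 2 + EE c₀ ε x0) := by positivity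
    linarith
  have h1 := hb x0 hx0' hz
  have h2 : ε ^ 2 * (z2 x0 - C * ((c₀ / ε) ^ 2 * EE c₀ ε x0)) ≤ 0 :=
    mul_nonpos_of_nonneg_of_nonpos hε2.le hs
  have h3 : ε ^ 2 * (C * ((c₀ / ε) ^ 2 * EE c₀ ε x0)) = C * c₀ ^ 2 * EE c₀ ε x0 := by
    field_simp
  have h4 : c₀ ^ 2 * (C * (ε ^ 2 + EE c₀ ε x0)) < c₀ ^ 2 * z x0 :=
    mul_lt_mul_of_pos_left (by linarith) (by positivity)
  have h5 : ε ^ 2 * R ≤ ε ^ 2 * (c₀ ^ 2 * C) := mul_le_mul_of_nonneg_left hC hε2.le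
  nlinarith

/-- interpolation inequality for the first derivative -/
lemma interp_deriv {c₀ ε A : ℝ} (hc₀ : 0 < c₀) (hε : 0 < ε) (hε1 : ε ≤ 1) (hA : 0 ≤ A)
    {g g1 g2 : ℝ → ℝ}
    (d1 : ∀ x ∈ Ioo (0:ℝ) 1, HasDerivAt g (g1 x) x)
    (d2 : ∀ x ∈ Ioo (0:ℝ) 1, HasDerivAt g1 (g2 x) x)
    (b0 : ∀ x ∈ Ioo (0:ℝ) 1, |g x| ≤ A * (ε ^ 2 + EE c₀ ε x))
    (b2 : ∀ x ∈ Ioo (0:ℝ) 1, |g2 x| ≤ A * (1 + EE c₀ ε x / ε ^ 2)) :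
    ∀ x ∈ Ioo (0:ℝ) 1, |g1 x| ≤ 9 * A * exp c₀ * (ε + EE c₀ ε x / ε) := by
  -- core estimate for a segment `[a,b]` of length `ε / 4`
  have core : ∀ a b x : ℝ, 0 < a → b < 1 → b = a + ε / 4 → x ∈ Icc a b →
      |g1 x| ≤ 9 * A * exp c₀ * (ε + EE c₀ ε x / ε) := by
    intro a b x ha hb hab hx
    have hlt : a < b := by linarith
    have hin : ∀ y ∈ Icc a b, y ∈ Ioo (0:ℝ) 1 := fun y hy => ⟨by linarith [hy.1], by linarith [hy.2]⟩
    set e := EE c₀ ε x with he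
    have hep : 0 < e := EE_pos _ _ _
    have hex1 : 1 ≤ exp c₀ := one_le_exp hc₀.le
    have hEy : ∀ y ∈ Icc a b, EE c₀ ε y ≤ exp c₀ * e := by
      intro y hy
      have h := EE_shift hc₀ hε (x := x) (y := y) (d := ε)
        (by rw [abs_le]; constructor <;> linarith [hy.1, hy.2, hx.1, hx.2])
      rwa [show c₀ / ε * ε = c₀ by field_simp] at h
    set S := exp c₀ * (ε + e / ε) with hS
    have hSp : 0 < S := by positivity
    have hg : ∀ y ∈ Icc a b, |g y| ≤ A * (ε * S) := by
      intro y hy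
      refine (b0 y (hin y hy)).trans (mul_le_mul_of_nonneg_left ?_ hA)
      have : ε * S = exp c₀ * ε ^ 2 + exp c₀ * e := by rw [hS]; field_simp
      rw [this]
      nlinarith [hEy y hy, sq_nonneg ε]
    have hg2 : ∀ y ∈ Icc a b, |g2 y| ≤ A * (S / ε) := by
      intro y hy
      refine (b2 y (hin y hy)).trans (mul_le_mul_of_nonneg_left ?_ hA)
      have : S / ε = exp c₀ + exp c₀ * e / ε ^ 2 := by rw [hS]; field_simp
      rw [this]
      have := hEy y hy
      gcongr
    obtain ⟨ξ, hξ, hξ'⟩ := exists_hasDerivAt_eq_slope g g1 hlt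
      (fun y hy => (d1 y (hin y hy)).continuousAt.continuousWithinAt)
      (fun y hy => d1 y (hin y (Ioo_subset_Icc_self hy)))
    have hab' : b - a = ε / 4 := by linarith
    have h1 : |g1 ξ| ≤ 8 * A * S := by
      rw [hξ', hab', abs_div, abs_of_pos (by positivity : (0:ℝ) < ε / 4),
        div_le_iff₀ (by positivity)]
      have := abs_sub (g b) (g a)
      have h2 := hg b ⟨hlt.le, le_rfl⟩
      have h3 := hg a ⟨le_rfl, hlt.le⟩
      nlinarith
    have h2 : |g1 x - g1 ξ| ≤ A * (S / ε) * |x - ξ| := by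
      have := (convex_Icc a b).norm_image_sub_le_of_norm_hasDerivWithin_le
        (f := g1) (f' := g2) (C := A * (S / ε)) (x := ξ) (y := x)
        (fun y hy => (d2 y (hin y hy)).hasDerivWithinAt) (fun y hy => hg2 y hy)
        (Ioo_subset_Icc_self hξ) hx
      simpa using this
    have h3 : |x - ξ| ≤ ε := by
      rw [abs_le]; constructor <;> linarith [hx.1, hx.2, hξ.1, hξ.2]
    have h4 : A * (S / ε) * |x - ξ| ≤ A * S := by
      calc A * (S / ε) * |x - ξ| ≤ A * (S / ε) * ε := by gcongr
        _ = A * S := by field_simp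
    have h5 : |g1 x| ≤ |g1 x - g1 ξ| + |g1 ξ| := by
      have := abs_add_le (g1 x - g1 ξ) (g1 ξ)
      simpa using this
    calc |g1 x| ≤ 9 * (A * S) := by linarith
      _ = _ := by rw [hS]; ring
  intro x hx
  rcases le_total x (1/2) with h | h
  · exact core x (x + ε / 4) x hx.1 (by linarith) rfl ⟨le_rfl, by linarith⟩
  · exact core (x - ε / 4) x x (by linarith) hx.2 (by ring) ⟨by linarith, le_rfl⟩


set_option maxHeartbeats 4000000 in
lemma sol_bounds {f : ℝ → ℝ → ℝ} {c₀ : ℝ} (hc₀ : 0 < c₀) (hf : SmoothF f) (hfu : LowerF f c₀) :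
    ∃ A : ℝ, 0 < A ∧ ∀ ε ∈ Ioc (0:ℝ) 1, ∀ u : ℝ → ℝ, IsSolution f ε u →
      ∃ u1 φ1 φ2 : ℝ → ℝ, SolB f c₀ A ε u u1 φ1 φ2 := by
  obtain ⟨v, v1, v2, R, hR, hvc, hv, hvR, hvd⟩ := reduced hc₀ hf hfu
  have hc2 : 0 < c₀ ^ 2 := by positivity
  set C := R + R / c₀ ^ 2 with hC
  have hCp : 0 < C := by positivity
  have hRC : R ≤ C := by
    have : 0 < R / c₀ ^ 2 := by positivity
    linarith
  have hRC2 : R ≤ c₀ ^ 2 * C := by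
    have : c₀ ^ 2 * C = c₀ ^ 2 * R + R := by rw [hC]; field_simp
    nlinarith
  obtain ⟨K, hK0, hK⟩ := unc_bounds hf (R + 3 * C)
  set A1 := K * C + R + C with hA1
  set B := 9 * A1 * exp c₀ with hB
  set D := B + R with hD
  set A2 := 4 * K * (1 + D) ^ 2 + K * (K * C) with hA2
  set A3 := K * C + A2 with hA3
  have hA1p : 0 < A1 := by positivity
  have hBp : 0 < B := by positivity
  have hDp : 0 < D := by positivity
  have hA2p : 0 < A2 := by positivity
  have hA3p : 0 < A3 := by positivity
  refine ⟨9 * A3 * exp c₀ + (R + 3 * C), by positivity, ?_⟩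
  rintro ε ⟨hε, hε1⟩ u ⟨hu, hode, hu0, hu1⟩
  have hε2 : 0 < ε ^ 2 := by positivity
  have hε21 : ε ^ 2 ≤ 1 := pow_le_one₀ hε.le hε1
  have hcd : ∀ x ∈ Ioo (0:ℝ) 1, ContDiffAt ℝ 4 u x := fun x hx =>
    hu.contDiffAt (Icc_mem_nhds hx.1 hx.2)
  have hd1 : ∀ x ∈ Ioo (0:ℝ) 1, HasDerivAt u (deriv u x) x := fun x hx =>
    ((hcd x hx).differentiableAt (by norm_num)).hasDerivAt
  have hd2 : ∀ x ∈ Ioo (0:ℝ) 1, HasDerivAt (deriv u) (f x (u x) / ε ^ 2) x := fun x hx => by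
    have h3 : ContDiffAt ℝ 3 (deriv u) x := (hcd x hx).derivWithin (by norm_num)
    have h4 := (h3.differentiableAt (by norm_num)).hasDerivAt
    have h5 : iteratedDerivWithin 2 u (Icc (0:ℝ) 1) x = deriv (deriv u) x := by
      rw [iteratedDerivWithin_succ, derivWithin_of_mem_nhds (Icc_mem_nhds hx.1 hx.2)]
      apply Filter.EventuallyEq.deriv_eq
      filter_upwards [Ioo_mem_nhds hx.1 hx.2] with t ht
      rw [iteratedDerivWithin_one, derivWithin_of_mem_nhds (Icc_mem_nhds ht.1 ht.2)]
    have h6 := hode x hx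
    rw [h5] at h6
    have h7 : deriv (deriv u) x = f x (u x) / ε ^ 2 := by
      rw [eq_div_iff hε2.ne']; linarith
    rwa [h7] at h4
  have huc : ContinuousOn u (Icc 0 1) := hu.continuousOn
  -- the difference
  have dz1 : ∀ x ∈ Ioo (0:ℝ) 1, HasDerivAt (fun x => u x - v x) (deriv u x - v1 x) x :=
    fun x hx => (hd1 x hx).sub (hvd x hx).1
  have dz2 : ∀ x ∈ Ioo (0:ℝ) 1,
      HasDerivAt (fun x => deriv u x - v1 x) (f x (u x) / ε ^ 2 - v2 x) x :=
    fun x hx => (hd2 x hx).sub (hvd x hx).2.1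
  have hv0 := abs_le.1 (hvR 0 (by simp))
  have hv1' := abs_le.1 (hvR 1 (by simp))
  have hup : ∀ x ∈ Icc (0:ℝ) 1, u x - v x ≤ C * (ε ^ 2 + EE c₀ ε x) := by
    refine cmp_aux (R := R) hc₀ hε (huc.sub hvc) ?_ ?_ hCp dz1 dz2 ?_ hRC2
    · simp only [hu0]; linarith
    · simp only [hu1]; linarith
    · intro x hx hz
      have h1 := f_mono hc₀ hfu (Ioo_subset_Icc_self hx) (sub_nonneg.1 hz)
      rw [hv x (Ioo_subset_Icc_self hx)] at h1
      have h2 : ε ^ 2 * (f x (u x) / ε ^ 2 - v2 x) = f x (u x) - ε ^ 2 * v2 x := by field_simp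
      rw [h2]
      have := mul_le_mul_of_nonneg_left (abs_le.1 (hvd x hx).2.2.2).2 hε2.le
      linarith
  have hlo : ∀ x ∈ Icc (0:ℝ) 1, -(u x - v x) ≤ C * (ε ^ 2 + EE c₀ ε x) := by
    refine cmp_aux (R := R) hc₀ hε (huc.sub hvc).neg ?_ ?_ hCp
      (fun x hx => (dz1 x hx).neg) (fun x hx => (dz2 x hx).neg) ?_ hRC2
    · simp only [hu0]; linarith
    · simp only [hu1]; linarith
    · intro x hx hz
      have h1 := f_mono hc₀ hfu (a := u x) (b := v x) (Ioo_subset_Icc_self hx) (by linarith)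
      rw [hv x (Ioo_subset_Icc_self hx)] at h1
      have h2 : ε ^ 2 * -(f x (u x) / ε ^ 2 - v2 x) = -f x (u x) + ε ^ 2 * v2 x := by
        field_simp; ring
      rw [h2]
      have := mul_le_mul_of_nonneg_left (abs_le.1 (hvd x hx).2.2.2).1 hε2.le
      linarith
  have hz : ∀ x ∈ Icc (0:ℝ) 1, |u x - v x| ≤ C * (ε ^ 2 + EE c₀ ε x) := fun x hx =>
    abs_le.2 ⟨by linarith [hlo x hx], hup x hx⟩
  have hub : ∀ x ∈ Icc (0:ℝ) 1, |u x| ≤ R + 3 * C := by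
    intro x hx
    have h1 := EE_le_two hc₀ hε hx
    have h2 := hz x hx
    have h3 := hvR x hx
    have h4 : |u x| ≤ |u x - v x| + |v x| := by
      simpa using abs_add_le (u x - v x) (v x)
    have h5 : C * (ε ^ 2 + EE c₀ ε x) ≤ C * 3 := mul_le_mul_of_nonneg_left (by linarith) hCp.le
    linarith
  have b0 : ∀ x ∈ Ioo (0:ℝ) 1, |f x (u x)| ≤ K * C * (ε ^ 2 + EE c₀ ε x) := by
    intro x hx
    have hxI := Ioo_subset_Icc_self hx
    have h1 := (convex_Icc (-(R + 3 * C)) (R + 3 * C)).norm_image_sub_le_of_norm_hasDerivWithin_le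
        (f := f x) (f' := fun y => fderiv ℝ (unc f) (x, y) (0, 1)) (C := K) (x := v x) (y := u x)
        (fun y hy => (pderiv1_eq hf hx y).hasDerivWithinAt) (fun y hy => by
          have := d1_bound (hK (x, y) hx (abs_le.2 hy)).1 0 1
          simpa using this)
        (abs_le.1 (by linarith [hvR x hxI])) (abs_le.1 (hub x hxI))
    rw [hv x hxI, sub_zero, Real.norm_eq_abs, Real.norm_eq_abs] at h1
    have := hz x hxI
    calc |f x (u x)| ≤ K * |u x - v x| := h1
      _ ≤ K * (C * (ε ^ 2 + EE c₀ ε x)) := by gcongr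
      _ = _ := by ring
  have b0' : ∀ x ∈ Ioo (0:ℝ) 1, |f x (u x) / ε ^ 2| ≤ K * C * (1 + EE c₀ ε x / ε ^ 2) := by
    intro x hx
    rw [abs_div, abs_of_pos hε2, div_le_iff₀ hε2]
    have := b0 x hx
    calc |f x (u x)| ≤ _ := this
      _ = _ := by field_simp
  have hz1 : ∀ x ∈ Ioo (0:ℝ) 1, |deriv u x - v1 x| ≤ B * (ε + EE c₀ ε x / ε) := by
    refine interp_deriv hc₀ hε hε1 hA1p.le dz1 dz2 ?_ ?_
    · intro x hx
      refine (hz x (Ioo_subset_Icc_self hx)).trans ?_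
      have := EE_pos c₀ ε x
      apply mul_le_mul_of_nonneg_right _ (by positivity)
      rw [hA1]; linarith [mul_pos hK0 hCp]
    · intro x hx
      have h1 := b0' x hx
      have h2 := (hvd x hx).2.2.2
      have h3 := abs_sub (f x (u x) / ε ^ 2) (v2 x)
      have h4 : 0 < EE c₀ ε x / ε ^ 2 := div_pos (EE_pos _ _ _) hε2
      calc _ ≤ _ := h3
        _ ≤ K * C * (1 + EE c₀ ε x / ε ^ 2) + R := by linarith
        _ ≤ _ := by
          have h5 : 0 ≤ R * (EE c₀ ε x / ε ^ 2) := by positivity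
          have h6 : 0 ≤ C * (1 + EE c₀ ε x / ε ^ 2) := by positivity
          rw [hA1]; linarith
  have hu1b : ∀ x ∈ Ioo (0:ℝ) 1, |deriv u x| ≤ D * (1 + EE c₀ ε x / ε) := by
    intro x hx
    have h1 := hz1 x hx
    have h2 := (hvd x hx).2.2.1
    have h3 : |deriv u x| ≤ |deriv u x - v1 x| + |v1 x| := by
      simpa using abs_add_le (deriv u x - v1 x) (v1 x)
    have h4 : 0 < EE c₀ ε x / ε := div_pos (EE_pos _ _ _) hε
    have h5 : 0 ≤ R * (EE c₀ ε x / ε) := by positivity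
    have h6 : B * ε ≤ B * 1 := mul_le_mul_of_nonneg_left hε1 hBp.le
    rw [hD]; linarith
  have dφ : ∀ x ∈ Ioo (0:ℝ) 1, HasDerivAt (fun x => f x (u x))
      (fderiv ℝ (unc f) (x, u x) (1, deriv u x)) x := fun x hx => curve_deriv hf hx (hd1 x hx)
  have dφ1 := fun x (hx : x ∈ Ioo (0:ℝ) 1) => curve_deriv2 hf hx (hd1 x hx) (hd2 x hx)
  have b2 : ∀ x ∈ Ioo (0:ℝ) 1,
      |fderiv ℝ (fderiv ℝ (unc f)) (x, u x) (1, deriv u x) (1, deriv u x)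
        + fderiv ℝ (unc f) (x, u x) (0, f x (u x) / ε ^ 2)| ≤ A2 * (1 + EE c₀ ε x / ε ^ 2) := by
    intro x hx
    have hxI := Ioo_subset_Icc_self hx
    have h1 := d2_bound (hK (x, u x) hx (hub x hxI)).2 1 (deriv u x) 1 (deriv u x)
    have h2 := d1_bound (hK (x, u x) hx (hub x hxI)).1 0 (f x (u x) / ε ^ 2)
    have h3 := b0' x hx
    have h4 := hu1b x hx
    have hE := EE_pos c₀ ε x
    have hE2 := EE_le_two hc₀ hε hxI
    set e := EE c₀ ε x with he
    have hq : 0 < e / ε := by positivity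
    have hq2 : (e / ε) ^ 2 ≤ 2 * (e / ε ^ 2) := by
      rw [div_pow, mul_div_assoc', div_le_div_iff_of_pos_right hε2]; nlinarith
    have h5 : 1 + |deriv u x| ≤ (1 + D) * (1 + e / ε) := by linarith
    have h6 : (1 + |deriv u x|) * (1 + |deriv u x|) ≤ 4 * (1 + D) ^ 2 * (1 + e / ε ^ 2) := by
      have h7 : (1 + |deriv u x|) ^ 2 ≤ ((1 + D) * (1 + e / ε)) ^ 2 :=
        pow_le_pow_left₀ (by positivity) h5 2
      have h8 : (1 + e / ε) ^ 2 ≤ 4 * (1 + e / ε ^ 2) := by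
        nlinarith [sq_nonneg (1 - e / ε)]
      rw [mul_pow] at h7
      have h9 : (1 + D) ^ 2 * (1 + e / ε) ^ 2 ≤ (1 + D) ^ 2 * (4 * (1 + e / ε ^ 2)) := by gcongr
      linarith
    have h10 := abs_add_le (fderiv ℝ (fderiv ℝ (unc f)) (x, u x) (1, deriv u x) (1, deriv u x))
      (fderiv ℝ (unc f) (x, u x) (0, f x (u x) / ε ^ 2))
    rw [abs_one] at h1
    rw [abs_zero, zero_add] at h2
    have h11 : K * ((1 + |deriv u x|) * (1 + |deriv u x|))
        ≤ K * (4 * (1 + D) ^ 2 * (1 + e / ε ^ 2)) := by gcongr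
    have h12 : K * |f x (u x) / ε ^ 2| ≤ K * (K * C * (1 + e / ε ^ 2)) := by gcongr
    calc _ ≤ _ := h10
      _ ≤ K * (4 * (1 + D) ^ 2 * (1 + e / ε ^ 2)) + K * (K * C * (1 + e / ε ^ 2)) := by
        have h13 : K * (1 + |deriv u x|) * (1 + |deriv u x|)
          = K * ((1 + |deriv u x|) * (1 + |deriv u x|)) := by ring
        linarith
      _ = _ := by rw [hA2]; ring
  have b1 := interp_deriv hc₀ hε hε1 hA3p.le dφ dφ1
    (fun x hx => (b0 x hx).trans (by
      have := EE_pos c₀ ε x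
      apply mul_le_mul_of_nonneg_right _ (by positivity)
      rw [hA3]; linarith))
    (fun x hx => (b2 x hx).trans (by
      have := EE_pos c₀ ε x
      apply mul_le_mul_of_nonneg_right _ (by positivity)
      have := mul_pos hK0 hCp
      rw [hA3]; linarith))
  have hex1 : 1 ≤ exp c₀ := one_le_exp hc₀.le
  have hA3e : A3 ≤ 9 * A3 * exp c₀ := by nlinarith
  have hKC := mul_pos hK0 hCp
  refine ⟨deriv u, fun x => fderiv ℝ (unc f) (x, u x) (1, deriv u x), _, huc, ?_, ?_, hd1, hd2,
    dφ, dφ1, ?_, ?_, ?_⟩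
  · have hcontf : ContinuousOn (unc f) ((Icc (0:ℝ) 1) ×ˢ univ) := ContDiffOn.continuousOn hf
    exact hcontf.comp (f := fun x : ℝ => (x, u x)) (continuousOn_id.prodMk huc)
      (fun x hx => ⟨hx, mem_univ _⟩)
  · intro x hx
    have := hub x hx
    have : 0 < 9 * A3 * exp c₀ := by positivity
    linarith
  · intro x hx
    refine (b0 x hx).trans ?_
    have := EE_pos c₀ ε x
    apply mul_le_mul_of_nonneg_right _ (by positivity)
    linarith
  · intro x hx
    refine (b1 x hx).trans ?_
    have := EE_pos c₀ ε x
    apply mul_le_mul_of_nonneg_right _ (by positivity)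
    linarith
  · intro x hx
    refine (b2 x hx).trans ?_
    have := EE_pos c₀ ε x
    apply mul_le_mul_of_nonneg_right _ (by positivity)
    linarith


/-- three-point second difference -/
def dd (a x b ga g gb : ℝ) : ℝ := 2 / (b - a) * ((gb - g) / (b - x) - (g - ga) / (x - a))

lemma convex_of_d2 {a b : ℝ} {g g1 g2 : ℝ → ℝ} (hc : ContinuousOn g (Icc a b))
    (d1 : ∀ x ∈ Ioo a b, HasDerivAt g (g1 x) x) (d2 : ∀ x ∈ Ioo a b, HasDerivAt g1 (g2 x) x)
    (h : ∀ x ∈ Ioo a b, 0 ≤ g2 x) : ConvexOn ℝ (Icc a b) g := by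
  apply convexOn_of_hasDerivWithinAt2_nonneg (convex_Icc a b) hc (f' := g1) (f'' := g2)
  · rw [interior_Icc]; exact fun x hx => (d1 x hx).hasDerivWithinAt
  · rw [interior_Icc]; exact fun x hx => (d2 x hx).hasDerivWithinAt
  · rw [interior_Icc]; exact h

lemma dd_nonneg {a x b : ℝ} {g : ℝ → ℝ} (hax : a < x) (hxb : x < b)
    (h : ConvexOn ℝ (Icc a b) g) : 0 ≤ dd a x b (g a) (g x) (g b) := by
  have h1 := h.slope_mono_adjacent (x := a) (y := x) (z := b) ⟨le_rfl, by linarith⟩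
    ⟨by linarith, le_rfl⟩ hax hxb
  unfold dd
  apply mul_nonneg
  · apply div_nonneg <;> linarith
  · linarith

lemma trunc_A {a x b s δ : ℝ} {g g1 g2 : ℝ → ℝ} (hax : a < x) (hxb : x < b)
    (hc : ContinuousOn g (Icc a b))
    (d1 : ∀ x ∈ Ioo a b, HasDerivAt g (g1 x) x) (d2 : ∀ x ∈ Ioo a b, HasDerivAt g1 (g2 x) x)
    (h : ∀ x ∈ Ioo a b, |g2 x - s| ≤ δ) : |dd a x b (g a) (g x) (g b) - s| ≤ δ := by
  have hq : ∀ k t : ℝ, HasDerivAt (fun t : ℝ => k * t ^ 2 / 2) (k * t) t := by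
    intro k t
    have := ((hasDerivAt_pow 2 t).const_mul k).div_const 2
    refine this.congr_deriv ?_
    simp; ring
  have hq2 : ∀ k t : ℝ, HasDerivAt (fun t : ℝ => k * t) k t := by
    intro k t
    simpa using (hasDerivAt_id t).const_mul k
  have n1 : b - a ≠ 0 := by intro h; linarith
  have n2 : b - x ≠ 0 := by intro h; linarith
  have n3 : x - a ≠ 0 := by intro h; linarith
  have h1 : ConvexOn ℝ (Icc a b) (fun t => g t - (s - δ) * t ^ 2 / 2) :=
    convex_of_d2 (hc.sub (by fun_prop)) (fun t ht => (d1 t ht).sub (hq _ t))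
      (fun t ht => (d2 t ht).sub (hq2 _ t)) (fun t ht => by linarith [(abs_le.1 (h t ht)).1])
  have h2 : ConvexOn ℝ (Icc a b) (fun t => (s + δ) * t ^ 2 / 2 - g t) :=
    convex_of_d2 (ContinuousOn.sub (by fun_prop) hc) (fun t ht => (hq _ t).sub (d1 t ht))
      (fun t ht => (hq2 _ t).sub (d2 t ht)) (fun t ht => by linarith [(abs_le.1 (h t ht)).2])
  have h3 := dd_nonneg hax hxb h1
  have h4 := dd_nonneg hax hxb h2
  have e3 : dd a x b (g a - (s - δ) * a ^ 2 / 2) (g x - (s - δ) * x ^ 2 / 2)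
      (g b - (s - δ) * b ^ 2 / 2) = dd a x b (g a) (g x) (g b) - (s - δ) := by
    unfold dd; field_simp; ring
  have e4 : dd a x b ((s + δ) * a ^ 2 / 2 - g a) ((s + δ) * x ^ 2 / 2 - g x)
      ((s + δ) * b ^ 2 / 2 - g b) = (s + δ) - dd a x b (g a) (g x) (g b) := by
    unfold dd; field_simp; ring
  rw [e3] at h3
  rw [e4] at h4
  rw [abs_le]; constructor <;> linarith

lemma convex_mid {a b : ℝ} {g : ℝ → ℝ} (h : ConvexOn ℝ (Icc a b) g) {x t : ℝ}
    (ht : t ∈ Icc a b) (ht' : 2 * x - t ∈ Icc a b) : 2 * g x ≤ g t + g (2 * x - t) := by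
  have h1 := h.2 ht ht' (by norm_num : (0:ℝ) ≤ 1 / 2) (by norm_num : (0:ℝ) ≤ 1 / 2) (by norm_num)
  simp only [smul_eq_mul] at h1
  rw [show 1 / 2 * t + 1 / 2 * (2 * x - t) = x by ring] at h1
  linarith

lemma convex_chord {a b : ℝ} {g : ℝ → ℝ} (h : ConvexOn ℝ (Icc a b) g) (hab : a < b) {t : ℝ}
    (ht : t ∈ Icc a b) : g t ≤ g a + (g b - g a) * (t - a) / (b - a) := by
  have hp : 0 < b - a := by linarith
  have h1 := h.2 (left_mem_Icc.2 hab.le) (right_mem_Icc.2 hab.le)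
    (show (0:ℝ) ≤ (b - t) / (b - a) from div_nonneg (by linarith [ht.2]) hp.le)
    (show (0:ℝ) ≤ (t - a) / (b - a) from div_nonneg (by linarith [ht.1]) hp.le)
    (by field_simp; ring)
  simp only [smul_eq_mul] at h1
  rw [show (b - t) / (b - a) * a + (t - a) / (b - a) * b = t by field_simp; ring] at h1
  refine h1.trans (le_of_eq ?_)
  field_simp; ring

lemma trunc_B {a x b ε S : ℝ} {u u1 φ φ1 φ2 Q Q1 Q2 : ℝ → ℝ} (hε : 0 < ε) (hax : a < x)
    (hb : b = 2 * x - a)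
    (hc : ContinuousOn u (Icc a b)) (hcφ : ContinuousOn φ (Icc a b)) (hcQ : ContinuousOn Q (Icc a b))
    (d1 : ∀ x ∈ Ioo a b, HasDerivAt u (u1 x) x)
    (d2 : ∀ x ∈ Ioo a b, HasDerivAt u1 (φ x / ε ^ 2) x)
    (p1 : ∀ x ∈ Ioo a b, HasDerivAt φ (φ1 x) x) (p2 : ∀ x ∈ Ioo a b, HasDerivAt φ1 (φ2 x) x)
    (q1 : ∀ x ∈ Ioo a b, HasDerivAt Q (Q1 x) x) (q2 : ∀ x ∈ Ioo a b, HasDerivAt Q1 (Q2 x) x)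
    (h : ∀ x ∈ Ioo a b, |φ2 x| ≤ Q2 x)
    (hS : ∀ t ∈ Ioo a b, Q t + Q (2 * x - t) - 2 * Q x ≤ S) :
    |ε ^ 2 * dd a x b (u a) (u x) (u b) - φ x| ≤ S / 2 := by
  have hε2 : 0 < ε ^ 2 := by positivity
  have c1 : ConvexOn ℝ (Icc a b) (fun t => Q t - φ t) :=
    convex_of_d2 (hcQ.sub hcφ) (fun t ht => (q1 t ht).sub (p1 t ht))
      (fun t ht => (q2 t ht).sub (p2 t ht)) (fun t ht => by linarith [(abs_le.1 (h t ht)).2])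
  have c2 : ConvexOn ℝ (Icc a b) (fun t => Q t + φ t) :=
    convex_of_d2 (hcQ.add hcφ) (fun t ht => (q1 t ht).add (p1 t ht))
      (fun t ht => (q2 t ht).add (p2 t ht)) (fun t ht => by linarith [(abs_le.1 (h t ht)).1])
  have hrefl : ∀ t ∈ Ioo a b, 2 * x - t ∈ Ioo a b := fun t ht =>
    ⟨by linarith [ht.2], by linarith [ht.1]⟩
  have hsym : ∀ t ∈ Ioo a b, |φ t + φ (2 * x - t) - 2 * φ x| ≤ S := by
    intro t ht
    have m1 := convex_mid c1 (x := x) (Ioo_subset_Icc_self ht) (Ioo_subset_Icc_self (hrefl t ht))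
    have m2 := convex_mid c2 (x := x) (Ioo_subset_Icc_self ht) (Ioo_subset_Icc_self (hrefl t ht))
    beta_reduce at m1 m2
    have := hS t ht
    rw [abs_le]; constructor <;> linarith
  have hr : ∀ t : ℝ, HasDerivAt (fun t : ℝ => 2 * x - t) (-1) t := fun t => by
    simpa using (hasDerivAt_id t).const_sub (2 * x)
  have key := trunc_A (a := a) (x := x) (b := b) (s := φ x / ε ^ 2) (δ := S / 2 / ε ^ 2)
    (g := fun t => (u t + u (2 * x - t)) / 2) (g1 := fun t => (u1 t - u1 (2 * x - t)) / 2)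
    (g2 := fun t => (φ t / ε ^ 2 + φ (2 * x - t) / ε ^ 2) / 2) hax (by linarith)
    ((hc.add (hc.comp (by fun_prop) (fun t ht => ⟨by linarith [ht.2], by linarith [ht.1]⟩))).div_const 2)
    (fun t ht => by
      have := ((d1 t ht).add ((d1 _ (hrefl t ht)).comp t (hr t))).div_const 2
      refine this.congr_deriv ?_
      ring)
    (fun t ht => by
      have := ((d2 t ht).sub ((d2 _ (hrefl t ht)).comp t (hr t))).div_const 2
      refine this.congr_deriv ?_
      ring)
    (fun t ht => by
      have e : (φ t / ε ^ 2 + φ (2 * x - t) / ε ^ 2) / 2 - φ x / ε ^ 2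
        = (φ t + φ (2 * x - t) - 2 * φ x) / 2 / ε ^ 2 := by field_simp
      rw [e, abs_div, abs_div, abs_of_pos hε2, abs_of_pos (by norm_num : (0:ℝ) < 2)]
      have := hsym t ht
      gcongr)
  have e1 : 2 * x - a = b := hb.symm
  have e2 : 2 * x - b = a := by linarith
  have e3 : 2 * x - x = x := by ring
  simp only [e1, e2, e3] at key
  have n1 : x - a ≠ 0 := by intro h; linarith
  have e4 : dd a x b ((u a + u b) / 2) ((u x + u x) / 2) ((u b + u a) / 2)
      = dd a x b (u a) (u x) (u b) := by
    unfold dd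
    have : b - x = x - a := by linarith
    rw [this]
    field_simp; ring
  rw [e4] at key
  have e5 : ε ^ 2 * dd a x b (u a) (u x) (u b) - φ x
      = ε ^ 2 * (dd a x b (u a) (u x) (u b) - φ x / ε ^ 2) := by field_simp
  rw [e5, abs_mul, abs_of_pos hε2]
  calc _ ≤ ε ^ 2 * (S / 2 / ε ^ 2) := by gcongr
    _ = S / 2 := by field_simp

lemma interp_I {a b t : ℝ} {g g1 g2 Q Q1 Q2 : ℝ → ℝ} (hab : a < b)
    (hc : ContinuousOn g (Icc a b)) (hcQ : ContinuousOn Q (Icc a b))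
    (p1 : ∀ x ∈ Ioo a b, HasDerivAt g (g1 x) x) (p2 : ∀ x ∈ Ioo a b, HasDerivAt g1 (g2 x) x)
    (q1 : ∀ x ∈ Ioo a b, HasDerivAt Q (Q1 x) x) (q2 : ∀ x ∈ Ioo a b, HasDerivAt Q1 (Q2 x) x)
    (h : ∀ x ∈ Ioo a b, |g2 x| ≤ Q2 x) (ht : t ∈ Icc a b) :
    |g a + (g b - g a) * (t - a) / (b - a) - g t|
      ≤ Q a + (Q b - Q a) * (t - a) / (b - a) - Q t := by
  have c1 : ConvexOn ℝ (Icc a b) (fun t => Q t - g t) :=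
    convex_of_d2 (hcQ.sub hc) (fun t ht => (q1 t ht).sub (p1 t ht))
      (fun t ht => (q2 t ht).sub (p2 t ht)) (fun t ht => by linarith [(abs_le.1 (h t ht)).2])
  have c2 : ConvexOn ℝ (Icc a b) (fun t => Q t + g t) :=
    convex_of_d2 (hcQ.add hc) (fun t ht => (q1 t ht).add (p1 t ht))
      (fun t ht => (q2 t ht).add (p2 t ht)) (fun t ht => by linarith [(abs_le.1 (h t ht)).1])
  have m1 := convex_chord c1 hab ht
  have m2 := convex_chord c2 hab ht
  beta_reduce at m1 m2
  have e1 : (Q b - g b - (Q a - g a)) * (t - a) / (b - a)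
    = (Q b - Q a) * (t - a) / (b - a) - (g b - g a) * (t - a) / (b - a) := by ring
  have e2 : (Q b + g b - (Q a + g a)) * (t - a) / (b - a)
    = (Q b - Q a) * (t - a) / (b - a) + (g b - g a) * (t - a) / (b - a) := by ring
  rw [e1] at m1
  rw [e2] at m2
  rw [abs_le]; constructor <;> linarith

/-- quadratic comparison function -/
lemma quad_deriv (k t : ℝ) : HasDerivAt (fun t : ℝ => k * t ^ 2 / 2) (k * t) t := by
  have := ((hasDerivAt_pow 2 t).const_mul k).div_const 2
  refine this.congr_deriv ?_
  simp; ring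

lemma lin_deriv (k t : ℝ) : HasDerivAt (fun t : ℝ => k * t) k t := by
  simpa using (hasDerivAt_id t).const_mul k

lemma EE_cont (c₀ ε : ℝ) : Continuous (EE c₀ ε) :=
  continuous_iff_continuousAt.2 fun x => (EE_deriv c₀ ε x).continuousAt

section cells
variable {f : ℝ → ℝ → ℝ} {c₀ A ε : ℝ} {u u1 φ1 φ2 : ℝ → ℝ}

lemma fine_bd (hc₀ : 0 < c₀) (hε : 0 < ε) (hε1 : ε ≤ 1) (hA : 0 ≤ A) {x : ℝ}
    (hx : x ∈ Ioo (0:ℝ) 1) : A * (1 + EE c₀ ε x / ε ^ 2) ≤ 3 * A / ε ^ 2 := by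
  have hε2 : 0 < ε ^ 2 := by positivity
  have hε21 : ε ^ 2 ≤ 1 := pow_le_one₀ hε.le hε1
  rw [le_div_iff₀ hε2]
  have e : A * (1 + EE c₀ ε x / ε ^ 2) * ε ^ 2 = A * (ε ^ 2 + EE c₀ ε x) := by field_simp
  rw [e]
  have := EE_le_two hc₀ hε (Ioo_subset_Icc_self hx)
  nlinarith

lemma u2_bd (hε : 0 < ε) (H : SolB f c₀ A ε u u1 φ1 φ2) {x : ℝ} (hx : x ∈ Ioo (0:ℝ) 1) :
    |f x (u x) / ε ^ 2| ≤ A * (1 + EE c₀ ε x / ε ^ 2) := by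
  have hε2 : 0 < ε ^ 2 := by positivity
  rw [abs_div, abs_of_pos hε2, div_le_iff₀ hε2]
  calc _ ≤ _ := H.b0 x hx
    _ = _ := by field_simp

lemma interp_fine (hc₀ : 0 < c₀) (hε : 0 < ε) (hε1 : ε ≤ 1) (hA : 0 ≤ A)
    (H : SolB f c₀ A ε u u1 φ1 φ2) {a b t : ℝ} (ha : 0 ≤ a) (hab : a < b) (hb : b ≤ 1)
    (ht : t ∈ Icc a b) :
    |u a + (u b - u a) * (t - a) / (b - a) - u t| ≤ 3 * A / ε ^ 2 * (b - a) ^ 2 := by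
  have hin : ∀ y ∈ Ioo a b, y ∈ Ioo (0:ℝ) 1 := fun y hy => ⟨by linarith [hy.1], by linarith [hy.2]⟩
  have hε2 : 0 < ε ^ 2 := by positivity
  have hM : 0 ≤ 3 * A / ε ^ 2 := by positivity
  set M := 3 * A / ε ^ 2
  have h := interp_I (Q := fun t => M * t ^ 2 / 2) (Q2 := fun _ => M) hab
    (H.cu.mono (Icc_subset_Icc ha hb)) (by fun_prop)
    (fun y hy => H.du y (hin y hy)) (fun y hy => H.du1 y (hin y hy))
    (fun y _ => quad_deriv M y) (fun y _ => lin_deriv M y)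
    (fun y hy => (u2_bd hε H (hin y hy)).trans (fine_bd hc₀ hε hε1 hA (hin y hy))) ht
  refine h.trans ?_
  have hn : b - a ≠ 0 := by intro h; linarith
  have e : M * a ^ 2 / 2 + (M * b ^ 2 / 2 - M * a ^ 2 / 2) * (t - a) / (b - a) - M * t ^ 2 / 2
      = M * ((t - a) * (b - t) / 2) := by field_simp; ring
  beta_reduce
  rw [e]
  apply mul_le_mul_of_nonneg_left _ hM
  nlinarith [ht.1, ht.2]

lemma interp_coarse (hc₀ : 0 < c₀) (hε : 0 < ε) (hA : 0 ≤ A)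
    (H : SolB f c₀ A ε u u1 φ1 φ2) {a b t η : ℝ} (ha : 0 ≤ a) (hab : a < b) (hb : b ≤ 1)
    (hη : ∀ y ∈ Icc a b, EE c₀ ε y ≤ η) (ht : t ∈ Icc a b) :
    |u a + (u b - u a) * (t - a) / (b - a) - u t| ≤ A * ((b - a) ^ 2 + η / c₀ ^ 2) := by
  have hin : ∀ y ∈ Ioo a b, y ∈ Ioo (0:ℝ) 1 := fun y hy => ⟨by linarith [hy.1], by linarith [hy.2]⟩
  have hε2 : 0 < ε ^ 2 := by positivity
  have hc2 : 0 < c₀ ^ 2 := by positivity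
  have hEc := EE_cont c₀ ε
  have h := interp_I (Q := fun t => A * t ^ 2 / 2 + A / c₀ ^ 2 * EE c₀ ε t)
    (Q2 := fun t => A + A / c₀ ^ 2 * ((c₀ / ε) ^ 2 * EE c₀ ε t)) hab
    (H.cu.mono (Icc_subset_Icc ha hb)) (by fun_prop)
    (fun y hy => H.du y (hin y hy)) (fun y hy => H.du1 y (hin y hy))
    (fun y _ => (quad_deriv A y).add ((EE_deriv c₀ ε y).const_mul _))
    (fun y _ => (lin_deriv A y).add ((EE1_deriv c₀ ε y).const_mul _))
    (fun y hy => (u2_bd hε H (hin y hy)).trans (le_of_eq (by field_simp))) ht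
  refine h.trans ?_
  have hp : 0 < b - a := by linarith
  have hn : b - a ≠ 0 := hp.ne'
  set θ := (t - a) / (b - a) with hθ
  have hθ0 : 0 ≤ θ := div_nonneg (by linarith [ht.1]) hp.le
  have hθ1 : θ ≤ 1 := by rw [hθ, div_le_one hp]; linarith [ht.2]
  have e : A * a ^ 2 / 2 + A / c₀ ^ 2 * EE c₀ ε a + (A * b ^ 2 / 2 + A / c₀ ^ 2 * EE c₀ ε b
      - (A * a ^ 2 / 2 + A / c₀ ^ 2 * EE c₀ ε a)) * (t - a) / (b - a)
      - (A * t ^ 2 / 2 + A / c₀ ^ 2 * EE c₀ ε t)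
      = A * ((t - a) * (b - t) / 2)
        + A / c₀ ^ 2 * ((1 - θ) * EE c₀ ε a + θ * EE c₀ ε b - EE c₀ ε t) := by
    rw [hθ]; field_simp; ring
  beta_reduce
  rw [e]
  have h1 : (t - a) * (b - t) / 2 ≤ (b - a) ^ 2 := by nlinarith [ht.1, ht.2]
  have h2 : (1 - θ) * EE c₀ ε a + θ * EE c₀ ε b - EE c₀ ε t ≤ η := by
    have i1 := hη a ⟨le_rfl, hab.le⟩
    have i2 := hη b ⟨hab.le, le_rfl⟩
    have i3 := EE_pos c₀ ε t
    nlinarith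
  calc _ ≤ A * (b - a) ^ 2 + A / c₀ ^ 2 * η := by gcongr
    _ = _ := by ring

lemma trunc_fine (hc₀ : 0 < c₀) (hε : 0 < ε) (hε1 : ε ≤ 1) (hA : 0 ≤ A)
    (H : SolB f c₀ A ε u u1 φ1 φ2) {a x b : ℝ} (ha : 0 ≤ a) (hax : a < x) (hb : b ≤ 1)
    (hbx : b = 2 * x - a) :
    |ε ^ 2 * dd a x b (u a) (u x) (u b) - f x (u x)| ≤ 3 * A / ε ^ 2 * (x - a) ^ 2 := by
  have hin : ∀ y ∈ Ioo a b, y ∈ Ioo (0:ℝ) 1 := fun y hy => ⟨by linarith [hy.1], by linarith [hy.2]⟩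
  have hε2 : 0 < ε ^ 2 := by positivity
  have hM : 0 ≤ 3 * A / ε ^ 2 := by positivity
  set M := 3 * A / ε ^ 2
  have h := trunc_B (φ := fun x => f x (u x)) (Q := fun t => M * t ^ 2 / 2) (Q2 := fun _ => M)
    (S := M * (x - a) ^ 2) hε hax hbx
    (H.cu.mono (Icc_subset_Icc ha hb)) (H.cφ.mono (Icc_subset_Icc ha hb)) (by fun_prop)
    (fun y hy => H.du y (hin y hy)) (fun y hy => H.du1 y (hin y hy))
    (fun y hy => H.dφ y (hin y hy)) (fun y hy => H.dφ1 y (hin y hy))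
    (fun y _ => quad_deriv M y) (fun y _ => lin_deriv M y)
    (fun y hy => (H.b2 y (hin y hy)).trans (fine_bd hc₀ hε hε1 hA (hin y hy)))
    (fun t ht => by
      have e : M * t ^ 2 / 2 + M * (2 * x - t) ^ 2 / 2 - 2 * (M * x ^ 2 / 2)
        = M * (t - x) ^ 2 := by ring
      beta_reduce
      rw [e]
      apply mul_le_mul_of_nonneg_left _ hM
      nlinarith [ht.1, ht.2])
  refine h.trans ?_
  have : 0 ≤ M * (x - a) ^ 2 := by positivity
  linarith

lemma trunc_coarse (hc₀ : 0 < c₀) (hε : 0 < ε) (hA : 0 ≤ A)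
    (H : SolB f c₀ A ε u u1 φ1 φ2) {a x b η : ℝ} (ha : 0 ≤ a) (hax : a < x) (hb : b ≤ 1)
    (hbx : b = 2 * x - a) (hη : ∀ y ∈ Icc a b, EE c₀ ε y ≤ η) :
    |ε ^ 2 * dd a x b (u a) (u x) (u b) - f x (u x)| ≤ A * ((x - a) ^ 2 + η / c₀ ^ 2) := by
  have hin : ∀ y ∈ Ioo a b, y ∈ Ioo (0:ℝ) 1 := fun y hy => ⟨by linarith [hy.1], by linarith [hy.2]⟩
  have hε2 : 0 < ε ^ 2 := by positivity
  have hc2 : 0 < c₀ ^ 2 := by positivity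
  have hEc := EE_cont c₀ ε
  have h := trunc_B (φ := fun x => f x (u x))
    (Q := fun t => A * t ^ 2 / 2 + A / c₀ ^ 2 * EE c₀ ε t)
    (Q2 := fun t => A + A / c₀ ^ 2 * ((c₀ / ε) ^ 2 * EE c₀ ε t))
    (S := A * (x - a) ^ 2 + A / c₀ ^ 2 * (2 * η)) hε hax hbx
    (H.cu.mono (Icc_subset_Icc ha hb)) (H.cφ.mono (Icc_subset_Icc ha hb)) (by fun_prop)
    (fun y hy => H.du y (hin y hy)) (fun y hy => H.du1 y (hin y hy))
    (fun y hy => H.dφ y (hin y hy)) (fun y hy => H.dφ1 y (hin y hy))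
    (fun y _ => (quad_deriv A y).add ((EE_deriv c₀ ε y).const_mul _))
    (fun y _ => (lin_deriv A y).add ((EE1_deriv c₀ ε y).const_mul _))
    (fun y hy => (H.b2 y (hin y hy)).trans (le_of_eq (by field_simp)))
    (fun t ht => by
      have e : A * t ^ 2 / 2 + A / c₀ ^ 2 * EE c₀ ε t
        + (A * (2 * x - t) ^ 2 / 2 + A / c₀ ^ 2 * EE c₀ ε (2 * x - t))
        - 2 * (A * x ^ 2 / 2 + A / c₀ ^ 2 * EE c₀ ε x)
        = A * (t - x) ^ 2 + A / c₀ ^ 2 * (EE c₀ ε t + EE c₀ ε (2 * x - t) - 2 * EE c₀ ε x) := by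
        ring
      beta_reduce
      rw [e]
      have h1 : (t - x) ^ 2 ≤ (x - a) ^ 2 := by nlinarith [ht.1, ht.2]
      have h2 : EE c₀ ε t + EE c₀ ε (2 * x - t) - 2 * EE c₀ ε x ≤ 2 * η := by
        have i1 := hη t (Ioo_subset_Icc_self ht)
        have i2 := hη (2 * x - t) ⟨by linarith [ht.2], by linarith [ht.1]⟩
        have i3 := EE_pos c₀ ε x
        linarith
      gcongr)
  refine h.trans ?_
  have h3 : 0 ≤ A * (x - a) ^ 2 := by positivity
  have h4 : A * ((x - a) ^ 2 + η / c₀ ^ 2)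
    = A * (x - a) ^ 2 + A / c₀ ^ 2 * (2 * η) / 2 := by ring
  linarith

lemma trunc_trans (hε : 0 < ε) (hA : 0 ≤ A)
    (H : SolB f c₀ A ε u u1 φ1 φ2) {a x b η : ℝ} (ha : 0 ≤ a) (hax : a < x) (hxb : x < b)
    (hb : b ≤ 1) (hη : ∀ y ∈ Icc a b, EE c₀ ε y ≤ η) :
    |ε ^ 2 * dd a x b (u a) (u x) (u b) - f x (u x)| ≤ 2 * A * (ε ^ 2 + η) ∧
    |ε ^ 2 * dd a x b (u a) (u x) (u b) - f x (u x)| ≤ A * (ε + η / ε) * (b - a) := by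
  have hin : ∀ y ∈ Ioo a b, y ∈ Ioo (0:ℝ) 1 := fun y hy => ⟨by linarith [hy.1], by linarith [hy.2]⟩
  have hε2 : 0 < ε ^ 2 := by positivity
  have gen : ∀ δ : ℝ, (∀ t ∈ Ioo a b, |f t (u t) - f x (u x)| ≤ δ) →
      |ε ^ 2 * dd a x b (u a) (u x) (u b) - f x (u x)| ≤ δ := by
    intro δ hδ
    have key := trunc_A (s := f x (u x) / ε ^ 2) (δ := δ / ε ^ 2) hax hxb
      (H.cu.mono (Icc_subset_Icc ha hb))
      (fun y hy => H.du y (hin y hy)) (fun y hy => H.du1 y (hin y hy))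
      (fun y hy => by
        rw [← sub_div, abs_div, abs_of_pos hε2]
        have := hδ y hy
        gcongr)
    have e5 : ε ^ 2 * dd a x b (u a) (u x) (u b) - f x (u x)
      = ε ^ 2 * (dd a x b (u a) (u x) (u b) - f x (u x) / ε ^ 2) := by field_simp
    rw [e5, abs_mul, abs_of_pos hε2]
    calc _ ≤ ε ^ 2 * (δ / ε ^ 2) := by gcongr
      _ = δ := by field_simp
  have hx : x ∈ Ioo a b := ⟨hax, hxb⟩
  constructor
  · apply gen
    intro t ht
    have h1 : |f t (u t)| ≤ A * (ε ^ 2 + η) := (H.b0 t (hin t ht)).trans (by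
      have := hη t (Ioo_subset_Icc_self ht)
      gcongr)
    have h2 : |f x (u x)| ≤ A * (ε ^ 2 + η) := (H.b0 x (hin x hx)).trans (by
      have := hη x (Ioo_subset_Icc_self hx)
      gcongr)
    have := abs_sub (f t (u t)) (f x (u x))
    linarith
  · apply gen
    intro t ht
    have h1 := (convex_Ioo a b).norm_image_sub_le_of_norm_hasDerivWithin_le
        (f := fun x => f x (u x)) (f' := φ1) (C := A * (ε + η / ε)) (x := x) (y := t)
        (fun y hy => (H.dφ y (hin y hy)).hasDerivWithinAt) (fun y hy => by
          refine (H.b1 y (hin y hy)).trans ?_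
          have := hη y (Ioo_subset_Icc_self hy)
          gcongr)
        hx ht
    rw [Real.norm_eq_abs, Real.norm_eq_abs] at h1
    have hη0 : 0 ≤ η := (EE_pos c₀ ε x).le.trans (hη x (Ioo_subset_Icc_self hx))
    have h2 : |t - x| ≤ b - a := by
      rw [abs_le]; constructor <;> linarith [ht.1, ht.2]
    exact h1.trans (by gcongr)
end cells


/-- discrete maximum principle -/
lemma dmp {x W b : ℕ → ℝ} {n : ℕ} {ε : ℝ} (hx : ∀ i < n, x i < x (i + 1))
    (h0 : 0 ≤ W 0) (hn : 0 ≤ W n) (hb : ∀ i, 1 ≤ i → i < n → 0 < b i)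
    (h : ∀ i, 1 ≤ i → i < n → 0 ≤ -ε ^ 2 * ddiff x W i + b i * W i) :
    ∀ i ≤ n, 0 ≤ W i := by
  obtain ⟨j, hj, hmin⟩ := Finset.exists_min_image (Finset.range (n + 1)) W ⟨0, by simp⟩
  have hjn : j ≤ n := by simpa [Nat.lt_succ_iff] using hj
  suffices hW : 0 ≤ W j by
    intro i hi
    exact hW.trans (hmin i (by simpa [Nat.lt_succ_iff] using hi))
  by_contra hneg
  push Not at hneg
  have hj0 : 1 ≤ j := by
    rcases Nat.eq_zero_or_pos j with h | h
    · rw [h] at hneg; linarith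
    · exact h
  have hjn' : j < n := by
    rcases hjn.eq_or_lt with h | h
    · rw [h] at hneg; linarith
    · exact h
  obtain ⟨k, rfl⟩ : ∃ k, j = k + 1 := ⟨j - 1, by omega⟩
  have m1 := hmin k (by simp; omega)
  have m2 := hmin (k + 1 + 1) (by simp; omega)
  have x1 := hx k (by omega)
  have x2 := hx (k + 1) (by omega)
  have hd : 0 ≤ ddiff x W (k + 1) := by
    unfold ddiff
    simp only [Nat.add_sub_cancel]
    apply mul_nonneg (div_nonneg (by norm_num) (by linarith))
    have a1 : 0 ≤ (W (k + 1 + 1) - W (k + 1)) / (x (k + 1 + 1) - x (k + 1)) :=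
      div_nonneg (by linarith) (by linarith)
    have a2 : (W (k + 1) - W k) / (x (k + 1) - x k) ≤ 0 :=
      div_nonpos_of_nonpos_of_nonneg (by linarith) (by linarith)
    linarith
  have h1 := h (k + 1) hj0 hjn'
  have h2 := mul_neg_of_pos_of_neg (hb (k + 1) hj0 hjn') hneg
  have h3 := mul_nonneg (sq_nonneg ε) hd
  nlinarith

/-- discrete stability with a barrier -/
lemma dstab {x e b B : ℕ → ℝ} {n : ℕ} {ε c T : ℝ} (hx : ∀ i < n, x i < x (i + 1)) (hc : 0 < c)
    (hT : 0 ≤ T) (e0 : e 0 = 0) (en : e n = 0) (hb : ∀ i, 1 ≤ i → i < n → c ≤ b i)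
    (hB : ∀ i ≤ n, 0 ≤ B i)
    (h : ∀ i, 1 ≤ i → i < n →
      |-ε ^ 2 * ddiff x e i + b i * e i| ≤ c * T - ε ^ 2 * ddiff x B i) :
    ∀ i ≤ n, |e i| ≤ T + B i := by
  have lin : ∀ s : ℝ, ∀ i, ddiff x (fun i => T + B i + s * e i) i
      = ddiff x B i + s * ddiff x e i := by
    intro s i
    unfold ddiff
    ring
  have key : ∀ s : ℝ, |s| = 1 → ∀ i ≤ n, 0 ≤ T + B i + s * e i := by
    intro s hs
    apply dmp (W := fun i => T + B i + s * e i) (b := b) (ε := ε) hx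
    · have := hB 0 (by omega)
      simp only [e0]; linarith
    · have := hB n le_rfl
      simp only [en]; linarith
    · exact fun i h1 h2 => hc.trans_le (hb i h1 h2)
    · intro i h1 h2
      rw [lin]
      have a1 := h i h1 h2
      have a2 : -|-ε ^ 2 * ddiff x e i + b i * e i|
          ≤ s * (-ε ^ 2 * ddiff x e i + b i * e i) := by
        have := neg_abs_le (s * (-ε ^ 2 * ddiff x e i + b i * e i))
        rwa [abs_mul, hs, one_mul] at this
      have a3 : c * T ≤ b i * T := mul_le_mul_of_nonneg_right (hb i h1 h2) hT
      have a4 : 0 ≤ b i * B i := mul_nonneg (hc.le.trans (hb i h1 h2)) (hB i h2.le)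
      nlinarith
  intro i hi
  have k1 := key 1 (by norm_num) i hi
  have k2 := key (-1) (by norm_num) i hi
  rw [abs_le]; constructor <;> linarith

/-- transition parameter -/
def sal (γ₀ ε : ℝ) (n : ℕ) : ℝ := min (1/4) (2 * γ₀⁻¹ * ε * Real.log n)

section mesh
variable {γ ε : ℝ} {m : ℕ}

lemma sm_left (hm : 1 ≤ m) {i : ℕ} (hi : i ≤ m) :
    shishkinMesh γ ε (4 * m) i = sal γ ε (4 * m) * i / m := by
  have hm' : (0:ℝ) < m := by exact_mod_cast hm
  have hi' : (i:ℝ) ≤ m := by exact_mod_cast hi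
  have ht : ((i:ℝ) / ((4 * m : ℕ) : ℝ)) ≤ 1 / 4 := by
    push_cast; rw [div_le_div_iff₀ (by positivity) (by norm_num)]; linarith
  unfold shishkinMesh shishkinLam
  simp only
  rw [if_pos ht, ← sal]
  push_cast
  field_simp

lemma sm_mid (hm : 1 ≤ m) {i : ℕ} (hi : m ≤ i) (hi3 : i ≤ 3 * m) :
    shishkinMesh γ ε (4 * m) i
      = sal γ ε (4 * m) + (1 - 2 * sal γ ε (4 * m)) * (i - m) / (2 * m) := by
  have hm' : (0:ℝ) < m := by exact_mod_cast hm
  have hi' : (m:ℝ) ≤ i := by exact_mod_cast hi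
  have hi3' : (i:ℝ) ≤ 3 * m := by exact_mod_cast hi3
  rcases hi.eq_or_lt with h | h
  · subst h
    rw [sm_left hm le_rfl]
    field_simp; ring
  have hil : (m:ℝ) < i := by exact_mod_cast h
  have ht : ¬ ((i:ℝ) / ((4 * m : ℕ) : ℝ)) ≤ 1 / 4 := by
    push_cast; rw [div_le_div_iff₀ (by positivity) (by norm_num)]; linarith
  unfold shishkinMesh shishkinLam
  simp only
  rw [if_neg ht, ← sal]
  split_ifs with h1 h2
  · push_cast; field_simp; ring
  · have : i = 3 * m := by
      have : (3 * m : ℝ) ≤ i := by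
        push_cast at h2
        have : (3:ℝ) / 4 ≤ (i:ℝ) / (4 * m) := by linarith
        rw [div_le_div_iff₀ (by norm_num) (by positivity)] at this
        linarith
      have : 3 * m ≤ i := by exact_mod_cast this
      omega
    subst this
    push_cast; field_simp; ring
  · push_cast; field_simp; ring

lemma sm_right (hm : 1 ≤ m) {i : ℕ} (hi : 3 * m ≤ i) :
    shishkinMesh γ ε (4 * m) i = 1 - sal γ ε (4 * m) * (4 * m - i) / m := by
  have hm' : (0:ℝ) < m := by exact_mod_cast hm
  have hi' : (3 * m:ℝ) ≤ i := by exact_mod_cast hi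
  have ht : ¬ ((i:ℝ) / ((4 * m : ℕ) : ℝ)) ≤ 1 / 4 := by
    push_cast; rw [div_le_div_iff₀ (by positivity) (by norm_num)]; linarith
  have ht2 : ¬ ((i:ℝ) / ((4 * m : ℕ) : ℝ)) ≤ 1 / 2 := by
    push_cast; rw [div_le_div_iff₀ (by positivity) (by norm_num)]; linarith
  have ht3 : 1 - ((i:ℝ) / ((4 * m : ℕ) : ℝ)) ≤ 1 / 4 := by
    have : (3:ℝ) / 4 ≤ (i:ℝ) / ((4 * m : ℕ) : ℝ) := by
      push_cast; rw [div_le_div_iff₀ (by norm_num) (by positivity)]; linarith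
    linarith
  unfold shishkinMesh shishkinLam
  simp only
  rw [if_neg ht, if_neg ht2, if_pos ht3, ← sal]
  push_cast
  field_simp

lemma st_left (hm : 1 ≤ m) {i : ℕ} (hi : i < m) :
    shishkinMesh γ ε (4 * m) (i + 1) = shishkinMesh γ ε (4 * m) i + sal γ ε (4 * m) / m := by
  rw [sm_left hm (by omega), sm_left hm (by omega)]
  push_cast; ring

lemma st_mid (hm : 1 ≤ m) {i : ℕ} (hi : m ≤ i) (hi3 : i < 3 * m) :
    shishkinMesh γ ε (4 * m) (i + 1)
      = shishkinMesh γ ε (4 * m) i + (1 - 2 * sal γ ε (4 * m)) / (2 * m) := by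
  rw [sm_mid hm (by omega) (by omega), sm_mid hm (by omega) (by omega)]
  push_cast; ring

lemma st_right (hm : 1 ≤ m) {i : ℕ} (hi : 3 * m ≤ i) :
    shishkinMesh γ ε (4 * m) (i + 1) = shishkinMesh γ ε (4 * m) i + sal γ ε (4 * m) / m := by
  rw [sm_right hm (by omega), sm_right hm (by omega)]
  push_cast; ring

lemma sm_zero (hm : 1 ≤ m) : shishkinMesh γ ε (4 * m) 0 = 0 := by
  rw [sm_left hm (by omega)]; simp

lemma sm_last (hm : 1 ≤ m) : shishkinMesh γ ε (4 * m) (4 * m) = 1 := by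
  rw [sm_right hm (by omega)]; simp

lemma sal_le : sal γ ε (4 * m) ≤ 1 / 4 := min_le_left _ _

lemma log4m (hm : 1 ≤ m) : 1 ≤ Real.log ((4 * m : ℕ) : ℝ) := by
  have hm' : (1:ℝ) ≤ m := by exact_mod_cast hm
  rw [Real.le_log_iff_exp_le (by push_cast; positivity)]
  push_cast
  linarith [Real.exp_one_lt_d9]

lemma sal_pos (hγ : 0 < γ) (hε : 0 < ε) (hm : 1 ≤ m) : 0 < sal γ ε (4 * m) := by
  have := log4m hm
  apply lt_min (by norm_num)
  have : 0 < Real.log ((4 * m : ℕ) : ℝ) := by linarith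
  positivity

lemma sm_strict (hγ : 0 < γ) (hε : 0 < ε) (hm : 1 ≤ m) : ∀ i < 4 * m,
    shishkinMesh γ ε (4 * m) i < shishkinMesh γ ε (4 * m) (i + 1) := by
  intro i hi
  have hm' : (0:ℝ) < m := by exact_mod_cast hm
  have ha := sal_pos hγ hε hm
  have ha2 : sal γ ε (4 * m) ≤ 1 / 4 := sal_le
  rcases lt_or_ge i m with h | h
  · rw [st_left hm h]
    have : 0 < sal γ ε (4 * m) / m := by positivity
    linarith
  rcases lt_or_ge i (3 * m) with h3 | h3
  · rw [st_mid hm h h3]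
    have : 0 < (1 - 2 * sal γ ε (4 * m)) / (2 * m) := div_pos (by linarith) (by positivity)
    linarith
  · rw [st_right hm h3]
    have : 0 < sal γ ε (4 * m) / m := by positivity
    linarith

lemma mono_of_steps {x : ℕ → ℝ} {n : ℕ} (hx : ∀ i < n, x i < x (i + 1)) {i j : ℕ} (hij : i ≤ j)
    (hj : j ≤ n) : x i ≤ x j := by
  induction j, hij using Nat.le_induction with
  | base => exact le_rfl
  | succ k hk ih => exact (ih (by omega)).trans (hx k (by omega)).le

lemma find_cell {x : ℕ → ℝ} {n : ℕ} {t : ℝ} (hn : 1 ≤ n) (h0 : x 0 ≤ t) (h1 : t ≤ x n) :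
    ∃ i < n, t ∈ Icc (x i) (x (i + 1)) := by
  induction n, hn using Nat.le_induction with
  | base => exact ⟨0, by omega, h0, h1⟩
  | succ k hk ih =>
    rcases le_total t (x k) with h | h
    · obtain ⟨i, hi, hc⟩ := ih h
      exact ⟨i, by omega, hc⟩
    · exact ⟨k, by omega, h, h1⟩

end mesh


section mesh2
variable {f : ℝ → ℝ → ℝ} {c₀ A ε γ : ℝ} {u u1 φ1 φ2 : ℝ → ℝ} {m : ℕ}

/-- the size `n⁻² ln² n` for `n = 4m` -/
def TT (m : ℕ) : ℝ := (Real.log ((4 * m : ℕ) : ℝ)) ^ 2 / (4 * (m:ℝ)) ^ 2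

lemma TT_ge (hm : 1 ≤ m) : 1 / (4 * (m:ℝ)) ^ 2 ≤ TT m := by
  have := log4m hm
  unfold TT
  have hm' : (0:ℝ) < m := by exact_mod_cast hm
  gcongr
  nlinarith

lemma step_fine (hm : 1 ≤ m) :
    sal γ ε (4 * m) / m ≤ 8 * γ⁻¹ * ε * Real.log ((4 * m : ℕ) : ℝ) / (4 * m) := by
  have hm' : (0:ℝ) < m := by exact_mod_cast hm
  have h : sal γ ε (4 * m) ≤ 2 * γ⁻¹ * ε * Real.log ((4 * m : ℕ) : ℝ) := min_le_right _ _
  rw [div_le_div_iff₀ hm' (by positivity)]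
  nlinarith

lemma fine_conv (hγ : 0 < γ) (hε : 0 < ε) (hA : 0 ≤ A) (hm : 1 ≤ m) {h : ℝ} (h0 : 0 ≤ h)
    (hh : h ≤ 8 * γ⁻¹ * ε * Real.log ((4 * m : ℕ) : ℝ) / (4 * m)) :
    3 * A / ε ^ 2 * h ^ 2 ≤ 192 * A * (γ⁻¹) ^ 2 * TT m := by
  have hm' : (0:ℝ) < m := by exact_mod_cast hm
  calc _ ≤ 3 * A / ε ^ 2 * (8 * γ⁻¹ * ε * Real.log ((4 * m : ℕ) : ℝ) / (4 * m)) ^ 2 := by gcongr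
    _ = _ := by unfold TT; field_simp; ring

lemma EE_mid (hc₀ : 0 < c₀) (hγ : 0 < γ) (hγc : γ ≤ c₀) (hε : 0 < ε) (hm : 1 ≤ m)
    (hα : sal γ ε (4 * m) < 1 / 4) {y : ℝ} (h1 : sal γ ε (4 * m) ≤ y)
    (h2 : y ≤ 1 - sal γ ε (4 * m)) : EE c₀ ε y ≤ 2 / (4 * (m:ℝ)) ^ 2 := by
  have hm' : (0:ℝ) < m := by exact_mod_cast hm
  have hL := log4m hm
  set L := Real.log ((4 * m : ℕ) : ℝ) with hLdef
  have hs : sal γ ε (4 * m) = 2 * γ⁻¹ * ε * L := by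
    rcases min_choice (1/4 : ℝ) (2 * γ⁻¹ * ε * Real.log ((4 * m : ℕ) : ℝ)) with h | h
    · unfold sal at hα; rw [h] at hα; exact absurd hα (lt_irrefl _)
    · exact h
  have key : ∀ z, sal γ ε (4 * m) ≤ z → Real.exp (-(c₀ / ε) * z) ≤ 1 / (4 * (m:ℝ)) ^ 2 := by
    intro z hz
    have h3 : 2 * L ≤ c₀ / ε * z := by
      calc 2 * L ≤ 2 * (c₀ / γ) * L := by
            have : 1 ≤ c₀ / γ := by rw [le_div_iff₀ hγ]; linarith
            nlinarith
        _ = c₀ / ε * sal γ ε (4 * m) := by rw [hs]; field_simp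
        _ ≤ _ := by gcongr
    have h4 : Real.exp (-(2 * L)) = 1 / (4 * (m:ℝ)) ^ 2 := by
      rw [Real.exp_neg, two_mul, Real.exp_add, hLdef, Real.exp_log (by push_cast; positivity)]
      push_cast
      field_simp
    rw [← h4]
    apply Real.exp_le_exp.2
    linarith
  have k1 := key y h1
  have k2 := key (1 - y) (by linarith)
  unfold EE
  calc _ ≤ 1 / (4 * (m:ℝ)) ^ 2 + 1 / (4 * (m:ℝ)) ^ 2 := add_le_add k1 k2
    _ = _ := by ring

/-- interpolation errors on the cells of the mesh -/
lemma mesh_interp (hc₀ : 0 < c₀) (hγ : 0 < γ) (hγc : γ ≤ c₀) (hε : 0 < ε) (hε1 : ε ≤ 1)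
    (hA : 0 ≤ A) (H : SolB f c₀ A ε u u1 φ1 φ2) (hm : 1 ≤ m) {x : ℕ → ℝ}
    (hx : x = shishkinMesh γ ε (4 * m)) {i : ℕ} (hi : i < 4 * m) {t : ℝ}
    (ht : t ∈ Icc (x i) (x (i + 1))) :
    |u (x i) + (u (x (i + 1)) - u (x i)) * (t - x i) / (x (i + 1) - x i) - u t|
      ≤ (192 * A * (γ⁻¹) ^ 2 + A * (4 + 2 / c₀ ^ 2)) * TT m := by
  have hm' : (0:ℝ) < m := by exact_mod_cast hm
  have hst : ∀ i < 4 * m, x i < x (i + 1) := by rw [hx]; exact sm_strict hγ hε hm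
  have x0 : x 0 = 0 := by rw [hx]; exact sm_zero hm
  have xn : x (4 * m) = 1 := by rw [hx]; exact sm_last hm
  have hα0 := sal_pos hγ hε hm
  have hα1 : sal γ ε (4 * m) ≤ 1 / 4 := sal_le
  have hT := TT_ge hm
  have hT0 : 0 ≤ TT m := le_trans (by positivity) hT
  have ha : 0 ≤ x i := by rw [← x0]; exact mono_of_steps hst (by omega) (by omega)
  have hb : x (i + 1) ≤ 1 := by rw [← xn]; exact mono_of_steps hst (by omega) (by omega)
  have fine : x (i + 1) - x i = sal γ ε (4 * m) / m →
      |u (x i) + (u (x (i + 1)) - u (x i)) * (t - x i) / (x (i + 1) - x i) - u t|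
      ≤ (192 * A * (γ⁻¹) ^ 2 + A * (4 + 2 / c₀ ^ 2)) * TT m := by
    intro h
    have h1 := interp_fine hc₀ hε hε1 hA H ha (hst i hi) hb ht
    have h2 := fine_conv (A := A) hγ hε hA hm (h := x (i + 1) - x i) (by linarith [hst i hi])
      (by rw [h]; exact step_fine hm)
    have h3 : 0 ≤ A * (4 + 2 / c₀ ^ 2) * TT m := by positivity
    linarith
  rcases lt_or_ge i m with h | h
  · apply fine; rw [hx, st_left hm h]; ring
  rcases lt_or_ge i (3 * m) with h3 | h3
  · have hs : x (i + 1) - x i = (1 - 2 * sal γ ε (4 * m)) / (2 * m) := by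
      rw [hx, st_mid hm h h3]; ring
    rcases hα1.eq_or_lt with hα | hα
    · apply fine; rw [hs, hα]; field_simp; norm_num
    have l1 : sal γ ε (4 * m) ≤ x i := by
      have : x m = sal γ ε (4 * m) := by rw [hx, sm_left hm le_rfl]; field_simp
      rw [← this]; exact mono_of_steps hst h (by omega)
    have l2 : x (i + 1) ≤ 1 - sal γ ε (4 * m) := by
      have : x (3 * m) = 1 - sal γ ε (4 * m) := by
        rw [hx, sm_right hm le_rfl]; push_cast; field_simp; ring
      rw [← this]; exact mono_of_steps hst (by omega) (by omega)
    have h1 := interp_coarse hc₀ hε hA H ha (hst i hi) hb (η := 2 / (4 * (m:ℝ)) ^ 2)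
      (fun y hy => EE_mid hc₀ hγ hγc hε hm hα (by linarith [hy.1]) (by linarith [hy.2])) ht
    have hs2 : x (i + 1) - x i ≤ 2 / (4 * m) := by
      rw [hs, div_le_div_iff₀ (by positivity) (by positivity)]
      nlinarith
    have hs0 : 0 ≤ x (i + 1) - x i := by linarith [hst i hi]
    calc _ ≤ _ := h1
      _ ≤ A * ((2 / (4 * m)) ^ 2 + 2 / (4 * (m:ℝ)) ^ 2 / c₀ ^ 2) := by gcongr
      _ = A * (4 + 2 / c₀ ^ 2) * (1 / (4 * (m:ℝ)) ^ 2) := by field_simp; ring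
      _ ≤ A * (4 + 2 / c₀ ^ 2) * TT m := by gcongr
      _ ≤ _ := by
        have h3 : 0 ≤ 192 * A * (γ⁻¹) ^ 2 * TT m := by positivity
        linarith
  · apply fine; rw [hx, st_right hm h3]; ring

/-- bound at a transition point -/
lemma trans_conv (hε : 0 < ε) (hA : 0 ≤ A) (hm : 1 ≤ m) {v η E0 d : ℝ} (hη : η = E0 * (2 / (4 * (m:ℝ)) ^ 2))
    (hE : 1 ≤ E0) (hd0 : 0 ≤ d) (hd : d ≤ 3 / (4 * m)) (h1 : v ≤ 2 * A * (ε ^ 2 + η))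
    (h2 : v ≤ A * (ε + η / ε) * d) :
    v ≤ A * (2 + 10 * E0) * (1 / (4 * (m:ℝ)) ^ 2) + 3 * A * ε / (4 * m) := by
  have hm' : (0:ℝ) < 4 * m := by have : (0:ℝ) < m := by exact_mod_cast hm
                                 linarith
  set n : ℝ := 4 * m with hn
  have hη0 : 0 ≤ η := by rw [hη]; positivity
  rcases le_total ε (1 / n) with h | h
  · have h3 : ε ^ 2 ≤ 1 / n ^ 2 := by
      calc ε ^ 2 ≤ (1 / n) ^ 2 := by gcongr
        _ = _ := by ring
    calc v ≤ _ := h1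
      _ ≤ 2 * A * (1 / n ^ 2 + η) := by gcongr
      _ = A * (2 + 4 * E0) * (1 / n ^ 2) := by rw [hη]; ring
      _ ≤ A * (2 + 10 * E0) * (1 / n ^ 2) := by gcongr; norm_num
      _ ≤ _ := by
        have : 0 ≤ 3 * A * ε / n := by positivity
        linarith
  · have h3 : η / ε ≤ 2 * E0 / n := by
      rw [div_le_iff₀ hε]
      calc η = 2 * E0 / n * (1 / n) := by rw [hη]; field_simp
        _ ≤ _ := by gcongr
    calc v ≤ _ := h2
      _ ≤ A * (ε + 2 * E0 / n) * (3 / n) := by gcongr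
      _ = A * (6 * E0) * (1 / n ^ 2) + 3 * A * ε / n := by field_simp; ring
      _ ≤ _ := by
        gcongr
        linarith

/-- barrier profile -/
def bar (α t : ℝ) : ℝ := max (-t) (max (-α) (t - 1))

lemma bar_convex (α : ℝ) (s : Set ℝ) (hs : Convex ℝ s) : ConvexOn ℝ s (bar α) := by
  have h1 : ConvexOn ℝ s (fun t : ℝ => -t) := (concaveOn_id hs).neg
  have h2 : ConvexOn ℝ s (fun _ : ℝ => -α) := convexOn_const _ hs
  have h3 : ConvexOn ℝ s (fun t : ℝ => t - 1) := (convexOn_id hs).sub (concaveOn_const _ hs)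
  exact h1.sup (h2.sup h3)

end mesh2


section mesh3
variable {f : ℝ → ℝ → ℝ} {c₀ A ε γ : ℝ} {u u1 φ1 φ2 : ℝ → ℝ} {m : ℕ}

lemma ddiff_succ (x y : ℕ → ℝ) (k : ℕ) : ddiff x y (k + 1)
    = dd (x k) (x (k + 1)) (x (k + 2)) (y k) (y (k + 1)) (y (k + 2)) := rfl

lemma dd_scale (P a x b p q r : ℝ) : dd a x b (-P * p) (-P * q) (-P * r) = -P * dd a x b p q r := by
  unfold dd; ring

set_option maxHeartbeats 2000000 in
/-- consistency errors, with barrier -/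
lemma mesh_trunc (hc₀ : 0 < c₀) (hγ : 0 < γ) (hγc : γ ≤ c₀) (hε : 0 < ε) (hε1 : ε ≤ 1)
    (hA : 0 ≤ A) (H : SolB f c₀ A ε u u1 φ1 φ2) (hm : 1 ≤ m) {x : ℕ → ℝ}
    (hx : x = shishkinMesh γ ε (4 * m)) :
    ∃ B : ℕ → ℝ, (∀ i ≤ 4 * m, 0 ≤ B i ∧ B i ≤ 9 * A * γ⁻¹ * TT m) ∧
      ∀ i, 1 ≤ i → i < 4 * m →
        |ε ^ 2 * ddiff x (fun j => u (x j)) i - f (x i) (u (x i))|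
          ≤ (192 * A * (γ⁻¹) ^ 2 + A * (4 + 2 / c₀ ^ 2)
            + A * (2 + 10 * Real.exp (8 * c₀ * γ⁻¹))) * TT m - ε ^ 2 * ddiff x B i := by
  have hm' : (0:ℝ) < m := by exact_mod_cast hm
  have hst : ∀ i < 4 * m, x i < x (i + 1) := by rw [hx]; exact sm_strict hγ hε hm
  have x0 : x 0 = 0 := by rw [hx]; exact sm_zero hm
  have xn : x (4 * m) = 1 := by rw [hx]; exact sm_last hm
  have hα0 := sal_pos hγ hε hm
  have hα1 : sal γ ε (4 * m) ≤ 1 / 4 := sal_le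
  have hα2 : sal γ ε (4 * m) ≤ 2 * γ⁻¹ * ε * Real.log ((4 * m : ℕ) : ℝ) := min_le_right _ _
  have hsf : sal γ ε (4 * m) / m ≤ 8 * γ⁻¹ * ε * Real.log ((4 * m : ℕ) : ℝ) / (4 * m) :=
    step_fine hm
  have hT := TT_ge hm
  have hT0 : 0 ≤ TT m := le_trans (by positivity) hT
  have xm : x m = sal γ ε (4 * m) := by rw [hx, sm_left hm le_rfl]; field_simp
  have x3m : x (3 * m) = 1 - sal γ ε (4 * m) := by
    rw [hx, sm_right hm le_rfl]; push_cast; field_simp; ring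
  have sl : ∀ i < m, x (i + 1) = x i + sal γ ε (4 * m) / m := by
    intro i hi; rw [hx]; exact st_left hm hi
  have sm : ∀ i, m ≤ i → i < 3 * m → x (i + 1) = x i + (1 - 2 * sal γ ε (4 * m)) / (2 * m) := by
    intro i hi hi3; rw [hx]; exact st_mid hm hi hi3
  have sr : ∀ i, 3 * m ≤ i → x (i + 1) = x i + sal γ ε (4 * m) / m := by
    intro i hi; rw [hx]; exact st_right hm hi
  have hEm : ∀ y, sal γ ε (4 * m) < 1 / 4 → sal γ ε (4 * m) ≤ y → y ≤ 1 - sal γ ε (4 * m) →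
      EE c₀ ε y ≤ 2 / (4 * (m:ℝ)) ^ 2 := fun y hα h1 h2 => EE_mid hc₀ hγ hγc hε hm hα h1 h2
  have hL := log4m hm
  have hLn : Real.log ((4 * m : ℕ) : ℝ) ≤ 4 * m := by
    have := Real.log_le_self (x := ((4 * m : ℕ) : ℝ)) (by positivity)
    push_cast at this ⊢; exact this
  have hTT : TT m = (Real.log ((4 * m : ℕ) : ℝ)) ^ 2 / (4 * (m:ℝ)) ^ 2 := rfl
  set L := Real.log ((4 * m : ℕ) : ℝ) with hLdef
  set α := sal γ ε (4 * m) with hαdef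
  set E0 := Real.exp (8 * c₀ * γ⁻¹) with hE0def
  have hγi : 0 < γ⁻¹ := inv_pos.2 hγ
  have hE0 : 1 ≤ E0 := Real.one_le_exp (by positivity)
  set P : ℝ := 9 / 2 * A / (ε * (4 * m) ^ 2) with hP
  have hP0 : 0 ≤ P := by positivity
  have hmem : ∀ i ≤ 4 * m, x i ∈ Icc (0:ℝ) 1 := fun i hi =>
    ⟨by rw [← x0]; exact mono_of_steps hst (by omega) (by omega),
     by rw [← xn]; exact mono_of_steps hst (by omega) (by omega)⟩
  refine ⟨fun i => -P * bar α (x i), ?_, ?_⟩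
  · intro i hi
    obtain ⟨h0, h1⟩ := hmem i hi
    have b1 : bar α (x i) ≤ 0 := by
      unfold bar
      refine max_le (by linarith) (max_le (by linarith) (by linarith))
    have b2 : -α ≤ bar α (x i) := le_trans (le_max_left _ _) (le_max_right _ _)
    constructor
    · nlinarith
    · calc -P * bar α (x i) ≤ P * α := by nlinarith
        _ ≤ P * (2 * γ⁻¹ * ε * L) := by gcongr
        _ = 9 * A * γ⁻¹ * (L / (4 * (m:ℝ)) ^ 2) := by rw [hP]; field_simp
        _ ≤ 9 * A * γ⁻¹ * TT m := by
          rw [hTT]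
          gcongr
          nlinarith
  intro i hi1 hi
  obtain ⟨k, rfl⟩ : ∃ k, i = k + 1 := ⟨i - 1, by omega⟩
  have hk1 := hst k (by omega)
  have hk2 : x (k + 1) < x (k + 2) := hst (k + 1) (by omega)
  have ha := (hmem k (by omega)).1
  have hb := (hmem (k + 2) (by omega)).2
  rw [ddiff_succ, ddiff_succ]
  beta_reduce
  rw [dd_scale]
  have hdd : 0 ≤ dd (x k) (x (k + 1)) (x (k + 2)) (bar α (x k)) (bar α (x (k + 1)))
      (bar α (x (k + 2))) := dd_nonneg hk1 hk2 (bar_convex α _ (convex_Icc _ _))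
  have hG0 : 0 ≤ P * dd (x k) (x (k + 1)) (x (k + 2)) (bar α (x k)) (bar α (x (k + 1)))
      (bar α (x (k + 2))) := mul_nonneg hP0 hdd
  have hε2 : 0 < ε ^ 2 := by positivity
  have hG1 := mul_nonneg hε2.le hG0
  have p1 : 0 ≤ 192 * A * (γ⁻¹) ^ 2 * TT m := by positivity
  have p2 : 0 ≤ A * (4 + 2 / c₀ ^ 2) * TT m := by positivity
  have p3 : 0 ≤ A * (2 + 10 * E0) * TT m := by positivity
  -- uniform fine node
  have fine : x (k + 1) - x k = α / m → x (k + 2) - x (k + 1) = α / m →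
      |ε ^ 2 * dd (x k) (x (k + 1)) (x (k + 2)) (u (x k)) (u (x (k + 1))) (u (x (k + 2)))
        - f (x (k + 1)) (u (x (k + 1)))| ≤ 192 * A * (γ⁻¹) ^ 2 * TT m := by
    intro s1 s2
    have h1 := trunc_fine hc₀ hε hε1 hA H ha hk1 hb (by linarith)
    have h2 := fine_conv (A := A) hγ hε hA hm (h := x (k + 1) - x k) (by linarith)
      (by rw [s1]; exact hsf)
    exact h1.trans h2
  -- transition node
  have trans : α < 1 / 4 → (∀ y ∈ Icc (x k) (x (k + 2)), EE c₀ ε y ≤ E0 * (2 / (4 * (m:ℝ)) ^ 2)) →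
      x (k + 2) - x k = α / m + (1 - 2 * α) / (2 * m) →
      dd (x k) (x (k + 1)) (x (k + 2)) (bar α (x k)) (bar α (x (k + 1))) (bar α (x (k + 2)))
        = 2 / (x (k + 2) - x k) →
      |ε ^ 2 * dd (x k) (x (k + 1)) (x (k + 2)) (u (x k)) (u (x (k + 1))) (u (x (k + 2)))
        - f (x (k + 1)) (u (x (k + 1)))| ≤ A * (2 + 10 * E0) * TT m + ε ^ 2 * (P *
        dd (x k) (x (k + 1)) (x (k + 2)) (bar α (x k)) (bar α (x (k + 1))) (bar α (x (k + 2)))) := by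
    intro hα hη hs hd
    have hs3 : x (k + 2) - x k ≤ 3 / (4 * m) := by
      rw [hs, div_add_div _ _ hm'.ne' (by positivity), div_le_div_iff₀ (by positivity) (by positivity)]
      nlinarith [mul_pos hm' hm']
    obtain ⟨h1, h2⟩ := trunc_trans hε hA H ha hk1 hk2 hb hη
    have h3 := trans_conv hε hA hm rfl hE0 (by linarith) hs3 h1 h2
    have hsp : 0 < x (k + 2) - x k := by linarith
    have h4 : 3 * A * ε / (4 * m) ≤ ε ^ 2 * (P * (2 / (x (k + 2) - x k))) := by
      calc 3 * A * ε / (4 * m) = ε ^ 2 * (P * (2 / (3 / (4 * m)))) := by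
            rw [hP]; field_simp; ring
        _ ≤ _ := by gcongr
    rw [hd]
    have h5 : A * (2 + 10 * E0) * (1 / (4 * (m:ℝ)) ^ 2) ≤ A * (2 + 10 * E0) * TT m := by gcongr
    linarith
  have shiftE : ∀ y z, |y - z| ≤ α / m → EE c₀ ε z ≤ 2 / (4 * (m:ℝ)) ^ 2 →
      EE c₀ ε y ≤ E0 * (2 / (4 * (m:ℝ)) ^ 2) := by
    intro y z hyz hz
    have h1 := EE_shift hc₀ hε hyz
    have h2 : c₀ / ε * (α / m) ≤ 8 * c₀ * γ⁻¹ := by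
      calc c₀ / ε * (α / m) ≤ c₀ / ε * (8 * γ⁻¹ * ε * L / (4 * m)) := by gcongr
        _ = 8 * c₀ * γ⁻¹ * (L / (4 * m)) := by field_simp
        _ ≤ 8 * c₀ * γ⁻¹ * 1 := by
          gcongr
          rw [div_le_one (by positivity)]; exact hLn
        _ = _ := by ring
    calc _ ≤ _ := h1
      _ ≤ E0 * (2 / (4 * (m:ℝ)) ^ 2) := by
        have := Real.exp_le_exp.2 h2
        have := EE_pos c₀ ε z
        gcongr
  have E0le : (2 / (4 * (m:ℝ)) ^ 2) ≤ E0 * (2 / (4 * (m:ℝ)) ^ 2) := by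
    have : (0:ℝ) ≤ 2 / (4 * (m:ℝ)) ^ 2 := by positivity
    nlinarith
  rcases hα1.eq_or_lt with hα | hα
  · -- uniform mesh
    have su : ∀ j < 4 * m, x (j + 1) - x j = α / m := by
      intro j hj
      rcases lt_or_ge j m with h | h
      · rw [sl j h]; ring
      rcases lt_or_ge j (3 * m) with h3 | h3
      · rw [sm j h h3, hα]; field_simp; norm_num
      · rw [sr j h3]; ring
    have := fine (su k (by omega)) (su (k + 1) (by omega))
    linarith
  rcases lt_trichotomy (k + 1) m with h | h | h
  · have := fine (by rw [sl k (by omega)]; ring)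
      (by rw [show x (k + 2) = _ from sl (k + 1) (by omega)]; ring)
    linarith
  · -- left transition point
    have e1 : x (k + 1) = x k + α / m := sl k (by omega)
    have e2 : x (k + 2) = x (k + 1) + (1 - 2 * α) / (2 * m) := sm (k + 1) (by omega) (by omega)
    have e3 : x (k + 1) = α := by rw [h, xm]
    have e4 : x (k + 2) ≤ 1 - α := by rw [← x3m]; exact mono_of_steps hst (by omega) (by omega)
    have := trans hα (fun y hy => by
        rcases le_total y α with hy2 | hy2
        · apply shiftE y α _ (hEm α hα le_rfl (by linarith))
          rw [abs_le]; constructor <;> linarith [hy.1]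
        · exact (hEm y hα hy2 (by linarith [hy.2])).trans E0le)
      (by linarith) (by
        have b1 : bar α (x k) = -x k := by
          unfold bar
          rw [max_eq_left]; apply max_le <;> linarith
        have b2 : bar α (x (k + 1)) = -α := by
          unfold bar
          rw [max_eq_left (by linarith : x (k + 1) - 1 ≤ -α), max_eq_right (by linarith)]
        have b3 : bar α (x (k + 2)) = -α := by
          unfold bar
          rw [max_eq_left (by linarith : x (k + 2) - 1 ≤ -α), max_eq_right (by linarith)]
        rw [b1, b2, b3]
        unfold dd
        have : -α - -x k = -(x (k + 1) - x k) := by rw [e3]; ring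
        rw [this, neg_div, div_self (by linarith)]
        ring)
    linarith
  rcases lt_trichotomy (k + 1) (3 * m) with h3 | h3 | h3
  · -- coarse node
    have e1 : x (k + 1) = x k + (1 - 2 * α) / (2 * m) := sm k (by omega) (by omega)
    have e2 : x (k + 2) = x (k + 1) + (1 - 2 * α) / (2 * m) := sm (k + 1) (by omega) (by omega)
    have l1 : α ≤ x k := by rw [← xm]; exact mono_of_steps hst (by omega) (by omega)
    have l2 : x (k + 2) ≤ 1 - α := by rw [← x3m]; exact mono_of_steps hst (by omega) (by omega)
    have h1 := trunc_coarse hc₀ hε hA H ha hk1 hb (by linarith) (η := 2 / (4 * (m:ℝ)) ^ 2)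
      (fun y hy => hEm y hα (by linarith [hy.1]) (by linarith [hy.2]))
    have hs2 : x (k + 1) - x k ≤ 2 / (4 * m) := by
      rw [e1, add_sub_cancel_left, div_le_div_iff₀ (by positivity) (by positivity)]
      nlinarith
    have hs0 : 0 ≤ x (k + 1) - x k := by linarith
    have h2 : A * ((x (k + 1) - x k) ^ 2 + 2 / (4 * (m:ℝ)) ^ 2 / c₀ ^ 2)
        ≤ A * (4 + 2 / c₀ ^ 2) * TT m := by
      calc _ ≤ A * ((2 / (4 * m)) ^ 2 + 2 / (4 * (m:ℝ)) ^ 2 / c₀ ^ 2) := by gcongr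
        _ = A * (4 + 2 / c₀ ^ 2) * (1 / (4 * (m:ℝ)) ^ 2) := by field_simp; ring
        _ ≤ A * (4 + 2 / c₀ ^ 2) * TT m := by gcongr
    linarith
  · -- right transition point
    have e1 : x (k + 1) = x k + (1 - 2 * α) / (2 * m) := sm k (by omega) (by omega)
    have e2 : x (k + 2) = x (k + 1) + α / m := sr (k + 1) (by omega)
    have e3 : x (k + 1) = 1 - α := by rw [h3, x3m]
    have e4 : α ≤ x k := by rw [← xm]; exact mono_of_steps hst (by omega) (by omega)
    have := trans hα (fun y hy => by
        rcases le_total y (1 - α) with hy2 | hy2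
        · exact (hEm y hα (by linarith [hy.1]) hy2).trans E0le
        · apply shiftE y (1 - α) _ (hEm (1 - α) hα (by linarith) (by linarith))
          rw [abs_le]; constructor <;> linarith [hy.2])
      (by linarith) (by
        have b1 : bar α (x k) = -α := by
          unfold bar
          rw [max_eq_left (by linarith : x k - 1 ≤ -α), max_eq_right (by linarith)]
        have b2 : bar α (x (k + 1)) = -α := by
          unfold bar
          rw [max_eq_left (by linarith : x (k + 1) - 1 ≤ -α), max_eq_right (by linarith)]
        have b3 : bar α (x (k + 2)) = x (k + 2) - 1 := by
          unfold bar
          rw [max_eq_right (by linarith : -α ≤ x (k + 2) - 1), max_eq_right (by linarith)]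
        rw [b1, b2, b3]
        unfold dd
        have : x (k + 2) - 1 - -α = (x (k + 2) - x (k + 1)) := by rw [e3]; ring
        rw [this, div_self (by linarith)]
        ring)
    linarith
  · have := fine (by rw [sr k (by omega)]; ring)
      (by rw [show x (k + 2) = _ from sr (k + 1) (by omega)]; ring)
    linarith

end mesh3


lemma taylor_u {f : ℝ → ℝ → ℝ} (hf : SmoothF f) {M K : ℝ}
    (hK : ∀ p : ℝ × ℝ, p.1 ∈ Ioo (0:ℝ) 1 → |p.2| ≤ M →
      ‖fderiv ℝ (unc f) p‖ ≤ K ∧ ‖fderiv ℝ (fderiv ℝ (unc f)) p‖ ≤ K)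
    {x y z : ℝ} (hx : x ∈ Ioo (0:ℝ) 1) (hy : |y| ≤ M) (hz : |z| ≤ M) :
    |f x z - f x y - pderiv1 f x y * (z - y)| ≤ K * (z - y) ^ 2 := by
  have hin : ∀ s ∈ uIcc y z, |s| ≤ M := by
    intro s hs
    rw [abs_le] at *
    rcases le_total y z with h | h
    · rw [uIcc_of_le h] at hs; constructor <;> linarith [hs.1, hs.2, hy.1, hz.2]
    · rw [uIcc_of_ge h] at hs; constructor <;> linarith [hs.1, hs.2, hy.2, hz.1]
  have hpd : ∀ s, pderiv1 f x s = fderiv ℝ (unc f) (x, s) (0, 1) := fun s =>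
    (pderiv1_eq hf hx s).deriv
  have hd2 : ∀ s, HasDerivAt (fun s => fderiv ℝ (unc f) (x, s) (0, 1))
      (fderiv ℝ (fderiv ℝ (unc f)) (x, s) (0, 1) (0, 1)) s := by
    intro s
    have h0 : ContDiffAt ℝ 3 (fderiv ℝ (unc f)) (x, s) :=
      (unc_contDiffAt hf (p := (x, s)) hx).fderiv_right (by norm_num)
    have h1 : HasFDerivAt (fderiv ℝ (unc f)) (fderiv ℝ (fderiv ℝ (unc f)) (x, s)) (x, s) :=
      (h0.differentiableAt (by norm_num)).hasFDerivAt
    have h2 := h1.comp_hasDerivAt s ((hasDerivAt_const s x).prodMk (hasDerivAt_id s))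
    have h3 := h2.clm_apply (hasDerivAt_const s ((0, 1) : ℝ × ℝ))
    simpa using h3
  have hlip : ∀ s ∈ uIcc y z, |fderiv ℝ (unc f) (x, s) (0, 1) - fderiv ℝ (unc f) (x, y) (0, 1)|
      ≤ K * |z - y| := by
    intro s hs
    have h1 := (convex_uIcc y z).norm_image_sub_le_of_norm_hasDerivWithin_le
      (f := fun s => fderiv ℝ (unc f) (x, s) (0, 1)) (C := K) (x := y) (y := s)
      (fun t _ => (hd2 t).hasDerivWithinAt) (fun t ht => by
        have := d2_bound (hK (x, t) hx (hin t ht)).2 0 1 0 1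
        rw [Real.norm_eq_abs]
        simpa using this) left_mem_uIcc hs
    rw [Real.norm_eq_abs, Real.norm_eq_abs] at h1
    have hK0 : 0 ≤ K := (norm_nonneg _).trans (hK (x, y) hx hy).1
    have h2 : |s - y| ≤ |z - y| := by
      have := abs_sub_left_of_mem_uIcc hs
      simpa [abs_sub_comm] using this
    exact h1.trans (by gcongr)
  have h4 := (convex_uIcc y z).norm_image_sub_le_of_norm_hasDerivWithin_le
      (f := fun s => f x s - pderiv1 f x y * s) (C := K * |z - y|) (x := y) (y := z)
      (f' := fun s => fderiv ℝ (unc f) (x, s) (0, 1) - pderiv1 f x y)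
      (fun t _ => ((pderiv1_eq hf hx t).sub (lin_deriv _ t)).hasDerivWithinAt) (fun t ht => by
        rw [Real.norm_eq_abs, hpd]
        exact hlip t ht) left_mem_uIcc right_mem_uIcc
  rw [Real.norm_eq_abs, Real.norm_eq_abs] at h4
  calc _ = |f x z - pderiv1 f x y * z - (f x y - pderiv1 f x y * y)| := by congr 1; ring
    _ ≤ _ := h4
    _ = K * (z - y) ^ 2 := by rw [mul_assoc, abs_mul_abs_self]; ring

/-- error of a (linearised) scheme on the Shishkin mesh, including interpolation -/
lemma mesh_err {c₀ A γ : ℝ} (hc₀ : 0 < c₀) (hγ : 0 < γ) (hγc : γ ≤ c₀) (hA : 0 < A) :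
    ∃ K : ℝ, 0 < K ∧ ∀ (f : ℝ → ℝ → ℝ) (ε : ℝ) (u u1 φ1 φ2 : ℝ → ℝ), 0 < ε → ε ≤ 1 →
      SolB f c₀ A ε u u1 φ1 φ2 → u 0 = 0 → u 1 = 0 → ∀ m : ℕ, 1 ≤ m →
      ∀ (y b r : ℕ → ℝ) (R : ℝ), 0 ≤ R → y 0 = 0 → y (4 * m) = 0 →
      (∀ i, 1 ≤ i → i < 4 * m → c₀ ^ 2 ≤ b i ∧ |r i| ≤ R ∧
        -ε ^ 2 * ddiff (shishkinMesh γ ε (4 * m)) y i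
          + b i * (y i - u (shishkinMesh γ ε (4 * m) i))
          = - f (shishkinMesh γ ε (4 * m) i) (u (shishkinMesh γ ε (4 * m) i)) + r i) →
      ∀ w : ℝ → ℝ, IsLinInterp (shishkinMesh γ ε (4 * m)) (4 * m) y w →
      ∀ t ∈ Icc (0:ℝ) 1, |w t - u t| ≤ K * TT m + R / c₀ ^ 2 := by
  set K0 := 192 * A * (γ⁻¹) ^ 2 + A * (4 + 2 / c₀ ^ 2) with hK0
  set K1 := K0 + A * (2 + 10 * Real.exp (8 * c₀ * γ⁻¹)) with hK1
  set K2 := 9 * A * γ⁻¹ with hK2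
  have k0 : 0 < K0 := by positivity
  have k1 : 0 < K1 := by positivity
  have k2 : 0 < K2 := by positivity
  have hc2 : 0 < c₀ ^ 2 := by positivity
  refine ⟨K1 / c₀ ^ 2 + K2 + K0, by positivity, ?_⟩
  intro f ε u u1 φ1 φ2 hε hε1 H u0 u1' m hm y b r R hR y0 yn heq w hw t ht
  have hst := sm_strict hγ hε hm
  have x0 : shishkinMesh γ ε (4 * m) 0 = 0 := sm_zero hm
  have xn : shishkinMesh γ ε (4 * m) (4 * m) = 1 := sm_last hm
  obtain ⟨B, hB, htr⟩ := mesh_trunc hc₀ hγ hγc hε hε1 hA.le H hm rfl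
  have hinterp : ∀ i < 4 * m, ∀ t ∈ Icc (shishkinMesh γ ε (4 * m) i) (shishkinMesh γ ε (4 * m) (i + 1)),
      _ := fun i hi t ht => mesh_interp hc₀ hγ hγc hε hε1 hA.le H hm rfl hi ht
  have hTT0 : 0 ≤ TT m := by unfold TT; positivity
  generalize shishkinMesh γ ε (4 * m) = x at *
  have hnode : ∀ i ≤ 4 * m, |y i - u (x i)| ≤ (K1 * TT m + R) / c₀ ^ 2 + B i := by
    apply dstab (b := b) (ε := ε) hst hc2 (by positivity)
    · rw [y0, x0, u0]; ring
    · rw [yn, xn, u1']; ring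
    · exact fun i h1 h2 => (heq i h1 h2).1
    · exact fun i hi => (hB i hi).1
    · intro i h1 h2
      obtain ⟨_, hr, he⟩ := heq i h1 h2
      have hl : ddiff x (fun i => y i - u (x i)) i = ddiff x y i - ddiff x (fun j => u (x j)) i := by
        unfold ddiff; ring
      rw [hl]
      have e : -ε ^ 2 * (ddiff x y i - ddiff x (fun j => u (x j)) i) + b i * (y i - u (x i))
          = (ε ^ 2 * ddiff x (fun j => u (x j)) i - f (x i) (u (x i))) + r i := by
        linarith
      rw [e, mul_div_cancel₀ _ hc2.ne']
      have h3 := htr i h1 h2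
      have h4 := abs_add_le (ε ^ 2 * ddiff x (fun j => u (x j)) i - f (x i) (u (x i))) (r i)
      linarith
  set G := (K1 * TT m + R) / c₀ ^ 2 + K2 * TT m with hG
  have hnode2 : ∀ i ≤ 4 * m, |y i - u (x i)| ≤ G := fun i hi =>
    (hnode i hi).trans (by have := (hB i hi).2; linarith)
  obtain ⟨i, hi, hti⟩ := find_cell (x := x) (n := 4 * m) (t := t) (by omega)
    (by rw [x0]; exact ht.1) (by rw [xn]; exact ht.2)
  have h1 := hinterp i hi t hti
  have hp : 0 < x (i + 1) - x i := by linarith [hst i hi]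
  rw [hw.2 i hi t hti]
  set θ := (t - x i) / (x (i + 1) - x i) with hθ
  have hθ0 : 0 ≤ θ := div_nonneg (by linarith [hti.1]) hp.le
  have hθ1 : θ ≤ 1 := by rw [hθ, div_le_one hp]; linarith [hti.2]
  have a1 := hnode2 i hi.le
  have a2 := hnode2 (i + 1) (by omega)
  rw [mul_div_assoc, ← hθ] at h1 ⊢
  have a3 : |(1 - θ) * (y i - u (x i)) + θ * (y (i + 1) - u (x (i + 1)))| ≤ G := by
    rw [abs_le] at a1 a2 ⊢
    constructor <;> nlinarith [a1.1, a1.2, a2.1, a2.2]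
  have e : y i + (y (i + 1) - y i) * θ - u t
      = ((1 - θ) * (y i - u (x i)) + θ * (y (i + 1) - u (x (i + 1))))
        + (u (x i) + (u (x (i + 1)) - u (x i)) * θ - u t) := by ring
  rw [e]
  refine (abs_add_le _ _).trans ((add_le_add a3 h1).trans (le_of_eq ?_))
  rw [hG, hK0]; ring

/-- error estimate of the two-grid algorithm on the Shishkin
mesh with `γ₀ = min(c₀,1)`, with fine mesh `n = N²`. -/
theorem stmt_17 (f : ℝ → ℝ → ℝ) (c₀ : ℝ) (hc₀ : 0 < c₀)
    (hf : SmoothF f) (hfu : LowerF f c₀) :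
    ∃ N₀ : ℕ, ∃ C : ℝ, 0 < C ∧
      ∀ ε ∈ Ioc (0:ℝ) 1, ∀ N : ℕ, N₀ ≤ N → 4 ∣ N →
      ∀ u : ℝ → ℝ, IsSolution f ε u →
      ∀ yH : ℕ → ℝ, NonlinScheme f ε (shishkinMesh (min c₀ 1) ε N) N yH →
      ∀ yint : ℝ → ℝ, IsLinInterp (shishkinMesh (min c₀ 1) ε N) N yH yint →
      ∀ yh : ℕ → ℝ,
        LinScheme (fun t => pderiv1 f t (yint t))
          (fun t => pderiv1 f t (yint t) * yint t - f t (yint t)) ε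
          (shishkinMesh (min c₀ 1) ε (N ^ 2)) (N ^ 2) yh →
      ∀ uI : ℝ → ℝ,
        IsLinInterp (shishkinMesh (min c₀ 1) ε (N ^ 2)) (N ^ 2) yh uI →
        ∀ x ∈ Icc (0:ℝ) 1,
          |uI x - u x| ≤ C * ((N:ℝ) ^ 4)⁻¹ * (Real.log N) ^ 4 := by
  obtain ⟨A, hA, hsol⟩ := sol_bounds hc₀ hf hfu
  have hγ : 0 < min c₀ 1 := lt_min hc₀ one_pos
  have hγc : min c₀ 1 ≤ c₀ := min_le_left _ _
  generalize min c₀ 1 = γ at *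
  obtain ⟨K, hK, herr⟩ := mesh_err hc₀ hγ hγc hA
  obtain ⟨D, hD, hDb⟩ := unc_bounds hf (A + K)
  have hc2 : 0 < c₀ ^ 2 := by positivity
  refine ⟨4, 4 * K + D * K ^ 2 / c₀ ^ 2, by positivity, ?_⟩
  intro ε hε N hN hdiv u hu yH hyH yint hyint yh hyh uI huI t ht
  obtain ⟨u1, φ1, φ2, H⟩ := hsol ε hε u hu
  obtain ⟨m, rfl⟩ := hdiv
  have hm : 1 ≤ m := by omega
  have hm' : (1:ℝ) ≤ m := by exact_mod_cast hm
  have hm2 : 1 ≤ 4 * m ^ 2 := by nlinarith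
  have hsq : (4 * m) ^ 2 = 4 * (4 * m ^ 2) := by ring
  rw [hsq] at hyh huI
  obtain ⟨_, _, u0, u1'⟩ := hu
  have hL := log4m hm
  have hTT : TT m = (Real.log ((4 * m : ℕ) : ℝ)) ^ 2 / (4 * (m:ℝ)) ^ 2 := rfl
  have hTT2 : TT (4 * m ^ 2) = 4 * (Real.log ((4 * m : ℕ) : ℝ)) ^ 2 / (4 * (m:ℝ)) ^ 4 := by
    unfold TT
    rw [← hsq, Nat.cast_pow, Real.log_pow]
    push_cast
    field_simp
    ring
  have hLn : Real.log ((4 * m : ℕ) : ℝ) ≤ 4 * m := by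
    have := Real.log_le_self (x := ((4 * m : ℕ) : ℝ)) (by positivity)
    push_cast at this ⊢; exact this
  have hTT1 : TT m ≤ 1 := by
    rw [hTT, div_le_one (by positivity)]
    gcongr
  have hTT0 : 0 ≤ TT m := by rw [hTT]; positivity
  have hmemI : ∀ k : ℕ, 1 ≤ k → ∀ i, 1 ≤ i → i < 4 * k →
      shishkinMesh γ ε (4 * k) i ∈ Ioo (0:ℝ) 1 := by
    intro k hk i h1 h2
    have hst := sm_strict hγ hε.1 hk
    have x0 : shishkinMesh γ ε (4 * k) 0 = 0 := sm_zero hk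
    have xn : shishkinMesh γ ε (4 * k) (4 * k) = 1 := sm_last hk
    constructor
    · have a := hst 0 (by omega)
      have b := mono_of_steps hst (i := 0 + 1) (j := i) (by omega) (by omega)
      linarith
    · have a := hst i (by omega)
      have b := mono_of_steps hst (i := i + 1) (j := 4 * k) (by omega) (by omega)
      linarith
  -- coarse grid error
  have hcoarse : ∀ t ∈ Icc (0:ℝ) 1, |yint t - u t| ≤ K * TT m := by
    have hs : ∀ i, ∃ s, 1 ≤ i → i < 4 * m → c₀ ^ 2 ≤ s ∧
        f (shishkinMesh γ ε (4 * m) i) (yH i)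
          - f (shishkinMesh γ ε (4 * m) i) (u (shishkinMesh γ ε (4 * m) i))
          = s * (yH i - u (shishkinMesh γ ε (4 * m) i)) := by
      intro i
      by_cases h : 1 ≤ i ∧ i < 4 * m
      · obtain ⟨s, hs⟩ := f_slope hc₀ hfu (Ioo_subset_Icc_self (hmemI m hm i h.1 h.2)) (yH i)
          (u (shishkinMesh γ ε (4 * m) i))
        exact ⟨s, fun _ _ => hs⟩
      · exact ⟨0, fun h1 h2 => absurd ⟨h1, h2⟩ h⟩
    choose b hb using hs
    intro t ht
    have := herr f ε u u1 φ1 φ2 hε.1 hε.2 H u0 u1' m hm yH b (fun _ => 0) 0 le_rfl hyH.2.1 hyH.2.2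
      (fun i h1 h2 => by
        refine ⟨(hb i h1 h2).1, by simp, ?_⟩
        have e1 := (hb i h1 h2).2
        have e2 := hyH.1 i h1 h2
        linarith) yint hyint t ht
    simpa using this
  have hfine := herr f ε u u1 φ1 φ2 hε.1 hε.2 H u0 u1' (4 * m ^ 2) hm2 yh
    (fun i => pderiv1 f (shishkinMesh γ ε (4 * (4 * m ^ 2)) i)
      (yint (shishkinMesh γ ε (4 * (4 * m ^ 2)) i)))
    (fun i => f (shishkinMesh γ ε (4 * (4 * m ^ 2)) i) (u (shishkinMesh γ ε (4 * (4 * m ^ 2)) i))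
      - f (shishkinMesh γ ε (4 * (4 * m ^ 2)) i) (yint (shishkinMesh γ ε (4 * (4 * m ^ 2)) i))
      - pderiv1 f (shishkinMesh γ ε (4 * (4 * m ^ 2)) i)
        (yint (shishkinMesh γ ε (4 * (4 * m ^ 2)) i))
        * (u (shishkinMesh γ ε (4 * (4 * m ^ 2)) i)
          - yint (shishkinMesh γ ε (4 * (4 * m ^ 2)) i)))
    (D * (K * TT m) ^ 2) (by positivity) hyh.2.1 hyh.2.2
    (fun i h1 h2 => by
      have hx := hmemI (4 * m ^ 2) hm2 i h1 h2
      have e := hyh.1 i h1 h2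
      beta_reduce at e
      generalize shishkinMesh γ ε (4 * (4 * m ^ 2)) i = z at *
      have hz := Ioo_subset_Icc_self hx
      have hc := hcoarse z hz
      have hub := H.bu z hz
      refine ⟨hfu z hz _, ?_, ?_⟩
      · have h3 := taylor_u hf hDb (x := z) (y := yint z) (z := u z) hx
          (by
            have h4 := abs_add_le (yint z - u z) (u z)
            rw [sub_add_cancel] at h4
            nlinarith) (by linarith)
        refine h3.trans ?_
        have h5 : (u z - yint z) ^ 2 ≤ (K * TT m) ^ 2 := by
          rw [sq_le_sq, abs_sub_comm, abs_of_nonneg (by positivity : 0 ≤ K * TT m)]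
          exact hc
        gcongr
      · linarith) uI huI t ht
  refine hfine.trans ?_
  rw [hTT2, hTT]
  have hcast : ((4 * m : ℕ) : ℝ) = 4 * (m:ℝ) := by push_cast; rfl
  set L := Real.log ((4 * m : ℕ) : ℝ) with hLd
  rw [hcast]
  have hp : (0:ℝ) < 4 * m := by linarith
  have hLL : L ^ 2 ≤ L ^ 4 := pow_le_pow_right₀ hL (by norm_num)
  calc _ ≤ K * (4 * L ^ 4 / (4 * (m:ℝ)) ^ 4) + D * (K * (L ^ 2 / (4 * (m:ℝ)) ^ 2)) ^ 2 / c₀ ^ 2 := by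
        gcongr
    _ = _ := by field_simp
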